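/- arXiv:2509.11920 — 8 statements merged into one kernel-verified Lean document; each statement's English description precedes it below -/
import Mathlib

section
/- Let dom be a set, V a finite set of variables, and R_1, …, R_m finite relations with R_i ⊆ dom^{X_i} where X_i ⊆ V. Let Y ⊆ V and A ∈ V ∖ Y, and let w_1, …, w_m be nonnegative reals forming a fractional edge cover of Y ∪ {A} (in particular, some X_i contains A). Then ∑_{y ∈ J} min_{i : A ∈ X_i} |{x[A] : x ∈ R_i, x[X_i ∩ Y] = y[X_i ∩ Y]}| ≤ ∏_{i=1}^{m} max(|R_i|, 1)^{w_i}, where J ⊆ dom^Y is the (finite) set of join-consistent tuples. -/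
open scoped ENNReal

namespace ENNReal

theorem tsum_rpow_le_rpow_tsum {α : Type*} (f : α → ℝ≥0∞) {s : ℝ} (hs : 1 ≤ s) :
    ∑' a, f a ^ s ≤ (∑' a, f a) ^ s := by
  have hsplit (t : ℝ≥0∞) : t ^ s = t * t ^ (s - 1) := by
    conv_lhs => rw [← add_sub_cancel 1 s]
    rw [rpow_add_of_nonneg _ _ zero_le_one (sub_nonneg.2 hs), rpow_one]
  simp_rw [hsplit]
  rw [← ENNReal.tsum_mul_right]
  exact ENNReal.tsum_le_tsum fun a =>
    mul_le_mul_right (rpow_le_rpow (ENNReal.le_tsum a) (sub_nonneg.2 hs)) _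

/-- **Hölder's inequality** for sums of finite products, with weights summing to at least one. -/
theorem tsum_prod_rpow_le {α ι : Type*} (s : Finset ι) (f : ι → α → ℝ≥0∞) {w : ι → ℝ}
    (hw : ∀ i ∈ s, 0 ≤ w i) (hsum : 1 ≤ ∑ i ∈ s, w i) :
    ∑' a, ∏ i ∈ s, f i a ^ w i ≤ ∏ i ∈ s, (∑' a, f i a) ^ w i := by
  set W := ∑ i ∈ s, w i
  have hW : W ≠ 0 := by positivity
  have hmul (i : ι) : W * (w i / W) = w i := mul_div_cancel₀ _ hW
  have holder : ∑' a, ∏ i ∈ s, (f i a ^ W) ^ (w i / W) ≤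
      ∏ i ∈ s, (∑' a, f i a ^ W) ^ (w i / W) := by
    let _ : MeasurableSpace α := ⊤
    simp_rw [← MeasureTheory.lintegral_count]
    refine lintegral_prod_norm_pow_le s (fun i _ => measurable_from_top.aemeasurable) ?_
      fun i hi => div_nonneg (hw i hi) (zero_le_one.trans hsum)
    rw [← Finset.sum_div, div_self hW]
  simp_rw [← rpow_mul, hmul] at holder
  refine holder.trans (Finset.prod_le_prod' fun i hi => ?_)
  calc (∑' a, f i a ^ W) ^ (w i / W) ≤ ((∑' a, f i a) ^ W) ^ (w i / W) :=
        rpow_le_rpow (tsum_rpow_le_rpow_tsum _ hsum)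
          (div_nonneg (hw i hi) (zero_le_one.trans hsum))
    _ = (∑' a, f i a) ^ w i := by rw [← rpow_mul, hmul]

end ENNReal

open Function in
/-- The sum of `g` over all tuples that agree with `x` outside `S`. -/
noncomputable def marginalSum {dom V : Type*} [DecidableEq V] (S : Finset V)
    (g : (V → dom) → ℝ≥0∞) (x : V → dom) : ℝ≥0∞ :=
  ∑' y : S → dom, g (updateFinset x S y)

namespace marginalSum

open Function

variable {dom V : Type*} [DecidableEq V]

theorem empty (g : (V → dom) → ℝ≥0∞) (x : V → dom) : marginalSum ∅ g x = g x := by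
  simp [marginalSum]

theorem insert {a : V} {S : Finset V} (ha : a ∉ S) (g : (V → dom) → ℝ≥0∞) (x : V → dom) :
    marginalSum (insert a S) g x = ∑' c, marginalSum S g (update x a c) := by
  have hd : Disjoint {a} S := Finset.disjoint_singleton_left.2 ha
  rw [Finset.insert_eq]
  unfold marginalSum
  rw [← (Equiv.piFinsetUnion (fun _ => dom) hd).tsum_eq, ENNReal.tsum_prod',
    ← (Equiv.funUnique ({a} : Finset V) dom).symm.tsum_eq]
  refine tsum_congr fun c => tsum_congr fun y => ?_
  rw [← updateFinset_updateFinset hd, update_eq_updateFinset]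
  rfl

theorem update_of_notMem {a : V} {S X : Finset V} {g : (V → dom) → ℝ≥0∞}
    (hg : DependsOn g (X : Set V)) (ha : a ∉ X) (x : V → dom) (c : dom) :
    marginalSum S g (update x a c) = marginalSum S g x := by
  refine tsum_congr fun y => hg fun v hv => ?_
  have hva : v ≠ a := fun h => ha (h ▸ hv)
  simp [updateFinset, hva]

/-- **Friedgut's inequality** for fractional edge covers. -/
theorem prod_rpow_le {ι : Type*} [Fintype ι] (X : ι → Finset V) (f : ι → (V → dom) → ℝ≥0∞)
    (hf : ∀ i, DependsOn (f i) (X i : Set V)) {w : ι → ℝ} (hw : ∀ i, 0 ≤ w i) (S : Finset V)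
    (hcov : ∀ B ∈ S, 1 ≤ ∑ i with B ∈ X i, w i) (x : V → dom) :
    marginalSum S (fun z => ∏ i, f i z ^ w i) x ≤ ∏ i, marginalSum (S ∩ X i) (f i) x ^ w i := by
  induction S using Finset.induction generalizing x with
  | empty => simp [empty]
  | insert a S ha ih =>
    have ih := ih fun B hB => hcov B (Finset.mem_insert_of_mem hB)
    rw [insert ha]
    calc ∑' c, marginalSum S (fun z => ∏ i, f i z ^ w i) (update x a c)
        ≤ ∑' c, ∏ i, marginalSum (S ∩ X i) (f i) (update x a c) ^ w i :=
          ENNReal.tsum_le_tsum fun c => ih _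
      _ = ∑' c, (∏ i with a ∈ X i, marginalSum (S ∩ X i) (f i) (update x a c) ^ w i) *
            ∏ i with a ∉ X i, marginalSum (S ∩ X i) (f i) x ^ w i := by
          refine tsum_congr fun c => ?_
          rw [← Finset.prod_filter_mul_prod_filter_not Finset.univ (fun i => a ∈ X i)]
          congr 1
          refine Finset.prod_congr rfl fun i hi => ?_
          rw [update_of_notMem (hf i) (Finset.mem_filter.1 hi).2]
      _ ≤ (∏ i with a ∈ X i, (∑' c, marginalSum (S ∩ X i) (f i) (update x a c)) ^ w i) *
            ∏ i with a ∉ X i, marginalSum (S ∩ X i) (f i) x ^ w i := by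
          rw [ENNReal.tsum_mul_right]
          gcongr
          exact ENNReal.tsum_prod_rpow_le _ _ (fun i _ => hw i)
            (hcov a (Finset.mem_insert_self a S))
      _ = ∏ i, marginalSum (Insert.insert a S ∩ X i) (f i) x ^ w i := by
          rw [← Finset.prod_filter_mul_prod_filter_not Finset.univ (fun i => a ∈ X i)]
          congr 1
          · refine Finset.prod_congr rfl fun i hi => ?_
            rw [Finset.insert_inter_of_mem (Finset.mem_filter.1 hi).2,
              insert fun h => ha (Finset.mem_inter.1 h).1]
          · refine Finset.prod_congr rfl fun i hi => ?_
            rw [Finset.insert_inter_of_notMem (Finset.mem_filter.1 hi).2]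

end marginalSum

open Classical in
/-- The tuples of the relation `R` that agree with `z` on the attributes in `Y`. -/
noncomputable def matchingTuples {dom V : Type*} {X : Finset V}
    (R : Finset ({A : V // A ∈ X} → dom)) (Y : Finset V) (z : V → dom) :
    Finset ({A : V // A ∈ X} → dom) :=
  R.filter fun x => ∀ (B : V) (hB : B ∈ X), B ∈ Y → x ⟨B, hB⟩ = z B

namespace matchingTuples

open Function

variable {dom V : Type*} {X : Finset V} (R : Finset ({A : V // A ∈ X} → dom)) (Y : Finset V)

theorem mem {z : V → dom} {x : {A : V // A ∈ X} → dom} :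
    x ∈ matchingTuples R Y z ↔ x ∈ R ∧ ∀ (B : V) (hB : B ∈ X), B ∈ Y → x ⟨B, hB⟩ = z B := by
  classical
  exact Finset.mem_filter

theorem dependsOn_card : DependsOn (fun z => ((matchingTuples R Y z).card : ℝ≥0∞)) (X : Set V) := by
  intro z z' h
  have : matchingTuples R Y z = matchingTuples R Y z' := by
    classical
    exact Finset.filter_congr fun x _ => forall₃_congr fun B hB _ => by rw [h B hB]
  simp only [this]

theorem marginalSum_card_le [DecidableEq V] (z : V → dom) :
    marginalSum (Y ∩ X) (fun z => ((matchingTuples R Y z).card : ℝ≥0∞)) z ≤ R.card := by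
  classical
  simp only [marginalSum, matchingTuples, Finset.card_filter, Nat.cast_sum]
  rw [Summable.tsum_finsetSum fun _ _ => ENNReal.summable, Finset.card_eq_sum_ones, Nat.cast_sum]
  refine Finset.sum_le_sum fun x _ => ?_
  rw [tsum_eq_single fun B => x ⟨B.1, (Finset.mem_inter.1 B.2).2⟩]
  · split_ifs <;> simp
  · intro y hy
    rw [if_neg, Nat.cast_zero]
    refine fun h => hy (funext fun B => ?_)
    obtain ⟨hBY, hBX⟩ := Finset.mem_inter.1 B.2
    rw [h B hBX hBY, updateFinset, dif_pos B.2]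

theorem mem_updateFinset [DecidableEq V] {z : V → dom} {y : Y → dom}
    {x : {A : V // A ∈ X} → dom} :
    x ∈ matchingTuples R Y (updateFinset z Y y) ↔
      x ∈ R ∧ ∀ (B : V) (hB : B ∈ X) (hB' : B ∈ Y), x ⟨B, hB⟩ = y ⟨B, hB'⟩ := by
  refine (mem R Y).trans <| and_congr_right fun _ => forall₃_congr fun B _ hB' => ?_
  rw [updateFinset, dif_pos hB']

end matchingTuples

theorem ENNReal.rpow_finset_sum {ι : Type*} {a : ℝ≥0∞} (ha : a ≠ 0) (ha' : a ≠ ∞) (w : ι → ℝ)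
    (s : Finset ι) : a ^ ∑ i ∈ s, w i = ∏ i ∈ s, a ^ w i := by
  classical
  induction s using Finset.induction with
  | empty => simp
  | insert i s hi ih => rw [Finset.sum_insert hi, Finset.prod_insert hi, rpow_add _ _ ha ha', ih]

/-- A lower bound for factors with total weight at least one bounds the weighted product, provided
the other factors are at least one. -/
theorem ENNReal.natCast_le_prod_rpow {ι : Type*} [Fintype ι] {w : ι → ℝ} (hw : ∀ i, 0 ≤ w i)
    (p : ι → Prop) [DecidablePred p] (hsum : 1 ≤ ∑ i with p i, w i) {k : ℕ} {N : ι → ℝ≥0∞}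
    (hN : ∀ i, 1 ≤ N i) (hk : ∀ i, p i → k ≤ N i) : (k : ℝ≥0∞) ≤ ∏ i, N i ^ w i := by
  have hone (i : ι) : 1 ≤ N i ^ w i := by
    simpa using rpow_le_rpow (hN i) (hw i)
  rcases Nat.eq_zero_or_pos k with rfl | hpos
  · simp
  have hk1 : (1 : ℝ≥0∞) ≤ k := by exact_mod_cast hpos
  have hk0 : (k : ℝ≥0∞) ≠ 0 := by exact_mod_cast hpos.ne'
  calc (k : ℝ≥0∞) = (k : ℝ≥0∞) ^ (1 : ℝ) := (rpow_one _).symm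
    _ ≤ (k : ℝ≥0∞) ^ ∑ i with p i, w i := rpow_le_rpow_of_exponent_le hk1 hsum
    _ = ∏ i with p i, (k : ℝ≥0∞) ^ w i :=
        rpow_finset_sum hk0 (natCast_ne_top k) w _
    _ ≤ ∏ i with p i, N i ^ w i :=
        Finset.prod_le_prod' fun i hi => rpow_le_rpow (hk i (Finset.mem_filter.1 hi).2) (hw i)
    _ ≤ ∏ i, N i ^ w i :=
        Finset.prod_le_prod_of_subset_of_one_le' (Finset.filter_subset _ _) fun i _ _ => hone i

/-- the key Generic-Join counting lemma, Lemma `app:gj` of the paper.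
Variables form a finite type `V`; relation `R i` is a finite set of tuples over the
attributes `X i` (a tuple over `X i` is a function `{A // A ∈ X i} → dom`).  Given
`Y ⊆ V`, `A ∉ Y`, and a fractional edge cover `w` of `Y ∪ {A}`, the sum, over all
join-consistent tuples `y ∈ dom^Y`, of the minimum over the relations containing `A`
of the number of `A`-values extending `y`, is at most `∏ i max(|R i|,1)^{w i}`.
(The sum is expressed as a `tsum` in `ℝ≥0∞`; the set of join-consistent tuples is
finite under the hypotheses, so this coincides with the finite sum.) -/
theorem stmt_0 {dom V : Type*} [Fintype V] [DecidableEq V]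
    {m : ℕ} (X : Fin m → Finset V)
    (R : (i : Fin m) → Finset ({A : V // A ∈ X i} → dom))
    (Y : Finset V) (A : V) (hAY : A ∉ Y)
    (w : Fin m → ℝ) (hw : ∀ i, 0 ≤ w i)
    (hcov : ∀ B ∈ insert A Y, 1 ≤ ∑ i ∈ Finset.univ.filter (fun i => B ∈ X i), w i)
    (hAX : ∃ i, A ∈ X i) :
    (∑' y : {y : {B : V // B ∈ Y} → dom //
        ∀ i : Fin m, ∃ x ∈ R i, ∀ (B : V) (hB : B ∈ X i) (hB' : B ∈ Y),
          x ⟨B, hB⟩ = y ⟨B, hB'⟩},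
      ((sInf {n : ℕ | ∃ (i : Fin m) (hAi : A ∈ X i),
          n = Set.ncard {a : dom | ∃ x ∈ R i, x ⟨A, hAi⟩ = a ∧
            ∀ (B : V) (hB : B ∈ X i) (hB' : B ∈ Y), x ⟨B, hB⟩ = y.1 ⟨B, hB'⟩}} : ℕ) : ℝ≥0∞))
      ≤ ∏ i : Fin m, ((max (R i).card 1 : ℕ) : ℝ≥0∞) ^ (w i) := by
  rcases isEmpty_or_nonempty dom with hdom | ⟨⟨d⟩⟩
  · obtain ⟨i, hi⟩ := hAX
    refine (ENNReal.tsum_eq_zero.2 fun y => ?_).trans_le zero_le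
    obtain ⟨x, -, -⟩ := y.2 i
    exact hdom.elim (x ⟨A, hi⟩)
  let N (i : Fin m) (z : V → dom) : ℝ≥0∞ := (matchingTuples (R i) Y z).card
  calc _ ≤ ∑' y : {y : {B : V // B ∈ Y} → dom //
            ∀ i : Fin m, ∃ x ∈ R i, ∀ (B : V) (hB : B ∈ X i) (hB' : B ∈ Y),
              x ⟨B, hB⟩ = y ⟨B, hB'⟩},
          ∏ i, N i (Function.updateFinset (fun _ => d) Y y.1) ^ w i := by
        refine ENNReal.tsum_le_tsum fun y => ?_
        refine ENNReal.natCast_le_prod_rpow hw (fun i => A ∈ X i)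
          (hcov A (Finset.mem_insert_self A Y)) (fun i => ?_) fun i hi => ?_
        · obtain ⟨x, hx⟩ := y.2 i
          exact Nat.one_le_cast.2
            (Finset.card_pos.2 ⟨x, (matchingTuples.mem_updateFinset _ _).2 hx⟩)
        · refine Nat.cast_le.2 (le_trans (Nat.sInf_le (Exists.intro i ⟨hi, rfl⟩)) ?_)
          classical
          refine le_trans ?_ (Finset.card_image_le
            (f := fun x : {B : V // B ∈ X i} → dom => x ⟨A, hi⟩))
          rw [← Set.ncard_coe_finset]
          refine Set.ncard_le_ncard ?_ (Finset.finite_toSet _)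
          rintro a ⟨x, hx, rfl, hxy⟩
          exact Finset.mem_image_of_mem _ ((matchingTuples.mem_updateFinset _ _).2 ⟨hx, hxy⟩)
    _ ≤ marginalSum Y (fun z => ∏ i, N i z ^ w i) fun _ => d :=
        ENNReal.tsum_comp_le_tsum_of_injective Subtype.val_injective
          fun y => ∏ i, N i (Function.updateFinset (fun _ => d) Y y) ^ w i
    _ ≤ ∏ i, marginalSum (Y ∩ X i) (N i) (fun _ => d) ^ w i :=
        marginalSum.prod_rpow_le X N (fun i => matchingTuples.dependsOn_card _ _) hw Y
          (fun B hB => hcov B (Finset.mem_insert_of_mem hB)) _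
    _ ≤ _ := Finset.prod_le_prod' fun i _ => ENNReal.rpow_le_rpow
        ((matchingTuples.marginalSum_card_le _ _ _).trans (Nat.cast_le.2 (le_max_left _ _))) (hw i)
end

section
/- Let dom be a set, V a finite set of variables, and R_1, …, R_m finite relations with R_i ⊆ dom^{X_i} where X_i ⊆ V. Let Y ⊆ Z ⊆ V and A ∈ V ∖ Z, let w_1, …, w_m be nonnegative reals forming a fractional edge cover of Y ∪ {A}, and let z : dom^Y → dom^Z be any map satisfying z(y)[Y] = y for every join-consistent y. Then ∑_{y ∈ J} min_{i : A ∈ X_i} |{x[A] : x ∈ R_i, x[X_i ∩ Z] = z(y)[X_i ∩ Z]}| ≤ ∏_{i=1}^{m} max(|R_i|, 1)^{w_i}, where J ⊆ dom^Y is the (finite) set of join-consistent tuples. -/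
open scoped ENNReal

open Classical in
/-- The tuples of `R` that agree with `y` on the common coordinates. -/
noncomputable def agreeing {dom V : Type*} {S : Finset V}
    (R : Finset ({B : V // B ∈ S} → dom)) (Y : Finset V) (y : {B : V // B ∈ Y} → dom) :
    Finset ({B : V // B ∈ S} → dom) :=
  R.filter fun x => ∀ (B : V) (hB : B ∈ S) (hB' : B ∈ Y), x ⟨B, hB⟩ = y ⟨B, hB'⟩

theorem mem_agreeing {dom V : Type*} {S : Finset V}
    {R : Finset ({B : V // B ∈ S} → dom)} {Y : Finset V} {y : {B : V // B ∈ Y} → dom}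
    {x : {B : V // B ∈ S} → dom} :
    x ∈ agreeing R Y y ↔
      x ∈ R ∧ ∀ (B : V) (hB : B ∈ S) (hB' : B ∈ Y), x ⟨B, hB⟩ = y ⟨B, hB'⟩ := by
  classical
  simp [agreeing]

theorem ENNReal.rpow_finsetSum_of_nonneg {ι : Type*} (s : Finset ι) {w : ι → ℝ}
    (hw : ∀ i ∈ s, 0 ≤ w i) (a : ℝ≥0∞) : a ^ (∑ i ∈ s, w i) = ∏ i ∈ s, a ^ w i := by
  classical
  induction s using Finset.induction with
  | empty => simp
  | insert i s hi ih =>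
    have hs : ∀ j ∈ s, 0 ≤ w j := fun j hj => hw j (Finset.mem_insert_of_mem hj)
    rw [Finset.sum_insert hi, Finset.prod_insert hi, ← ih hs,
      ENNReal.rpow_add_of_nonneg _ _ (hw i (Finset.mem_insert_self i s)) (Finset.sum_nonneg hs)]

theorem ENNReal.tsum_rpow_le_rpow_tsum_s1 {α : Type*} (h : α → ℝ≥0∞) {p : ℝ} (hp : 1 ≤ p) :
    ∑' a, h a ^ p ≤ (∑' a, h a) ^ p := by
  have key : ∀ t : ℝ≥0∞, t ^ p = t * t ^ (p - 1) := fun t => by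
    conv_lhs => rw [← add_sub_cancel 1 p]
    rw [ENNReal.rpow_add_of_nonneg _ _ zero_le_one (sub_nonneg.2 hp), ENNReal.rpow_one]
  rw [key (∑' a, h a), ← ENNReal.tsum_mul_right]
  refine ENNReal.tsum_le_tsum fun a => ?_
  rw [key]
  gcongr
  exact ENNReal.le_tsum a

/-- Hölder's inequality for sums, with nonnegative exponents of total weight at least one. -/
theorem ENNReal.tsum_prod_rpow_le_s1 {α ι : Type*} (s : Finset ι) (f : ι → α → ℝ≥0∞) {w : ι → ℝ}
    (hw : ∀ i ∈ s, 0 ≤ w i) (hs : 1 ≤ ∑ i ∈ s, w i) :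
    ∑' a, ∏ i ∈ s, f i a ^ w i ≤ ∏ i ∈ s, (∑' a, f i a) ^ w i := by
  set p := ∑ i ∈ s, w i
  have hp0 : 0 < p := by linarith
  have split : ∀ g : ι → ℝ≥0∞, ∏ i ∈ s, g i ^ w i = (∏ i ∈ s, g i ^ (w i / p)) ^ p := fun g => by
    rw [← ENNReal.prod_rpow_of_nonneg hp0.le]
    refine Finset.prod_congr rfl fun i _ => ?_
    rw [← ENNReal.rpow_mul, div_mul_cancel₀ _ hp0.ne']
  simp_rw [split]
  refine (ENNReal.tsum_rpow_le_rpow_tsum_s1 _ hs).trans ?_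
  gcongr
  let _ : MeasurableSpace α := ⊤
  simp_rw [← MeasureTheory.lintegral_count]
  refine ENNReal.lintegral_prod_norm_pow_le s (fun i _ => measurable_from_top.aemeasurable) ?_
    fun i hi => div_nonneg (hw i hi) hp0.le
  rw [← Finset.sum_div, div_self hp0.ne']

open Classical in
theorem ENNReal.tsum_card_filter_eq {α β : Type*} (s : Finset α) (g : α → β) :
    ∑' b, ((s.filter fun x => g x = b).card : ℝ≥0∞) = s.card := by
  simp_rw [Finset.card_filter, Nat.cast_sum]
  rw [Summable.tsum_finsetSum fun _ _ => ENNReal.summable]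
  simp

open Classical in
theorem agreeing_insert {dom V : Type*} [DecidableEq V] {S : Finset V}
    (R : Finset ({B : V // B ∈ S} → dom)) (Y : Finset V) (B : V)
    (y : {C : V // C ∈ insert B Y} → dom) :
    agreeing R (insert B Y) y =
      (agreeing R Y fun C => y ⟨C.1, Finset.mem_insert_of_mem C.2⟩).filter
        fun x => ∀ hB : B ∈ S, x ⟨B, hB⟩ = y ⟨B, Finset.mem_insert_self B Y⟩ := by
  ext x
  simp only [mem_agreeing, Finset.mem_filter]
  constructor
  · rintro ⟨hx, h⟩
    exact ⟨⟨hx, fun C hC _ => h C hC _⟩, fun hB => h B hB _⟩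
  · rintro ⟨⟨hx, h⟩, h'⟩
    refine ⟨hx, fun C hC hC' => ?_⟩
    rcases Finset.mem_insert.1 hC' with rfl | hCY
    · exact h' hC
    · exact h C hC hCY

/-- The weighted AGM bound, summed over all tuples of the covered set. -/
theorem tsum_prod_card_agreeing_le {dom V ι : Type*} [Fintype ι] [DecidableEq V]
    (X : ι → Finset V) (R : (i : ι) → Finset ({B : V // B ∈ X i} → dom)) (Y : Finset V)
    {w : ι → ℝ} (hw : ∀ i, 0 ≤ w i)
    (hcov : ∀ B ∈ Y, 1 ≤ ∑ i ∈ Finset.univ.filter (fun i => B ∈ X i), w i) :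
    ∑' y : {B : V // B ∈ Y} → dom, ∏ i, ((agreeing (R i) Y y).card : ℝ≥0∞) ^ w i
      ≤ ∏ i, ((R i).card : ℝ≥0∞) ^ w i := by
  classical
  induction Y using Finset.induction with
  | empty =>
    have : IsEmpty {B : V // B ∈ (∅ : Finset V)} := ⟨fun B => absurd B.2 (Finset.notMem_empty _)⟩
    rw [tsum_fintype, Fintype.sum_unique]
    refine Finset.prod_le_prod' fun i _ => ?_
    refine ENNReal.rpow_le_rpow (Nat.cast_le.2 (Finset.card_le_card ?_)) (hw i)
    exact fun x hx => (mem_agreeing.1 hx).1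
  | insert B Y hBY ih =>
    let e : ({C : V // C ∈ insert B Y} → dom) → ({C : V // C ∈ Y} → dom) × dom := fun y =>
      (fun C => y ⟨C.1, Finset.mem_insert_of_mem C.2⟩, y ⟨B, Finset.mem_insert_self B Y⟩)
    have he : Function.Injective e := by
      intro y y' h
      funext ⟨C, hC⟩
      rcases Finset.mem_insert.1 hC with rfl | hCY
      · exact congrArg Prod.snd h
      · exact congrFun (congrArg Prod.fst h) ⟨C, hCY⟩
    let F : ι → ({C : V // C ∈ Y} → dom) → dom → ℝ≥0∞ := fun i y b =>
      (((agreeing (R i) Y y).filter fun x => ∀ hB : B ∈ X i, x ⟨B, hB⟩ = b).card : ℝ≥0∞)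
    calc ∑' y, ∏ i, ((agreeing (R i) (insert B Y) y).card : ℝ≥0∞) ^ w i
        = ∑' y, (fun q : ({C : V // C ∈ Y} → dom) × dom => ∏ i, F i q.1 q.2 ^ w i) (e y) := by
          simp only [agreeing_insert, F, e]
      _ ≤ ∑' q : ({C : V // C ∈ Y} → dom) × dom, ∏ i, F i q.1 q.2 ^ w i :=
          ENNReal.tsum_comp_le_tsum_of_injective he _
      _ = ∑' y, ∑' b, ∏ i, F i y b ^ w i :=
          ENNReal.tsum_prod (f := fun y b => ∏ i, F i y b ^ w i)
      _ ≤ ∑' y, ∏ i, ((agreeing (R i) Y y).card : ℝ≥0∞) ^ w i := ?_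
      _ ≤ _ := ih fun C hC => hcov C (Finset.mem_insert_of_mem hC)
    refine ENNReal.tsum_le_tsum fun y => ?_
    rw [← Finset.prod_filter_mul_prod_filter_not Finset.univ (fun i => B ∈ X i)]
    calc ∑' b, ∏ i, F i y b ^ w i
        = ∑' b, (∏ i ∈ Finset.univ.filter (fun i => B ∈ X i), F i y b ^ w i) *
            ∏ i ∈ Finset.univ.filter (fun i => B ∉ X i),
              ((agreeing (R i) Y y).card : ℝ≥0∞) ^ w i := by
          refine tsum_congr fun b => ?_
          rw [← Finset.prod_filter_mul_prod_filter_not Finset.univ (fun i => B ∈ X i)]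
          congr 1
          refine Finset.prod_congr rfl fun i hi => ?_
          simp [F, (Finset.mem_filter.1 hi).2]
      _ ≤ _ := by
          rw [ENNReal.tsum_mul_right]
          gcongr
          refine (ENNReal.tsum_prod_rpow_le_s1 _ _ (fun i _ => hw i)
            (hcov B (Finset.mem_insert_self B Y))).trans_eq ?_
          refine Finset.prod_congr rfl fun i hi => ?_
          have hB := (Finset.mem_filter.1 hi).2
          simp only [F, hB, forall_true_left]
          rw [ENNReal.tsum_card_filter_eq]

/-- the strengthened Generic-Join counting lemma, Lemma `app:gj2`.
As in Statement 0, but the restricting tuple is `z y ∈ dom^Z` for an arbitrary map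
`z : dom^Y → dom^Z` extending each join-consistent `y` (here `Y ⊆ Z ⊆ V`, `A ∉ Z`). -/
theorem stmt_1 {dom V : Type*} [Fintype V] [DecidableEq V]
    {m : ℕ} (X : Fin m → Finset V)
    (R : (i : Fin m) → Finset ({A : V // A ∈ X i} → dom))
    (Y Z : Finset V) (hYZ : Y ⊆ Z) (A : V) (hAZ : A ∉ Z)
    (w : Fin m → ℝ) (hw : ∀ i, 0 ≤ w i)
    (hcov : ∀ B ∈ insert A Y, 1 ≤ ∑ i ∈ Finset.univ.filter (fun i => B ∈ X i), w i)
    (z : ({B : V // B ∈ Y} → dom) → ({B : V // B ∈ Z} → dom))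
    (hz : ∀ y : {B : V // B ∈ Y} → dom,
      (∀ i : Fin m, ∃ x ∈ R i, ∀ (B : V) (hB : B ∈ X i) (hB' : B ∈ Y),
        x ⟨B, hB⟩ = y ⟨B, hB'⟩) →
      ∀ (B : V) (hB : B ∈ Y), z y ⟨B, hYZ hB⟩ = y ⟨B, hB⟩) :
    (∑' y : {y : {B : V // B ∈ Y} → dom //
        ∀ i : Fin m, ∃ x ∈ R i, ∀ (B : V) (hB : B ∈ X i) (hB' : B ∈ Y),
          x ⟨B, hB⟩ = y ⟨B, hB'⟩},
      ((sInf {n : ℕ | ∃ (i : Fin m) (hAi : A ∈ X i),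
          n = Set.ncard {a : dom | ∃ x ∈ R i, x ⟨A, hAi⟩ = a ∧
            ∀ (B : V) (hB : B ∈ X i) (hBZ : B ∈ Z),
              x ⟨B, hB⟩ = z y.1 ⟨B, hBZ⟩}} : ℕ) : ℝ≥0∞))
      ≤ ∏ i : Fin m, ((max (R i).card 1 : ℕ) : ℝ≥0∞) ^ (w i) := by
  have hA := hcov A (Finset.mem_insert_self A Y)
  calc _ ≤ ∑' y : {y : {B : V // B ∈ Y} → dom //
        ∀ i : Fin m, ∃ x ∈ R i, ∀ (B : V) (hB : B ∈ X i) (hB' : B ∈ Y),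
          x ⟨B, hB⟩ = y ⟨B, hB'⟩}, ∏ i, ((agreeing (R i) Y y.1).card : ℝ≥0∞) ^ w i := ?_
    _ ≤ ∑' y, ∏ i, ((agreeing (R i) Y y).card : ℝ≥0∞) ^ w i :=
        ENNReal.tsum_comp_le_tsum_of_injective Subtype.val_injective
          fun y => ∏ i, ((agreeing (R i) Y y).card : ℝ≥0∞) ^ w i
    _ ≤ ∏ i, ((R i).card : ℝ≥0∞) ^ w i :=
        tsum_prod_card_agreeing_le X R Y hw fun B hB => hcov B (Finset.mem_insert_of_mem hB)
    _ ≤ _ := by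
        gcongr with i
        · exact hw i
        · exact le_max_left _ _
  refine ENNReal.tsum_le_tsum ?_
  rintro ⟨y, hy⟩
  set N := sInf {n : ℕ | ∃ (i : Fin m) (hAi : A ∈ X i),
    n = Set.ncard {a : dom | ∃ x ∈ R i, x ⟨A, hAi⟩ = a ∧
      ∀ (B : V) (hB : B ∈ X i) (hBZ : B ∈ Z), x ⟨B, hB⟩ = z y ⟨B, hBZ⟩}}
  have hNle : ∀ i, A ∈ X i → N ≤ (agreeing (R i) Y y).card := by
    classical
    intro i hAi
    refine le_trans (Nat.sInf_le (Exists.intro i ⟨hAi, rfl⟩)) ?_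
    refine le_trans ?_ (Finset.card_image_le (f := fun x => x ⟨A, hAi⟩))
    rw [← Set.ncard_coe_finset]
    refine Set.ncard_le_ncard ?_ (Finset.finite_toSet _)
    rintro a ⟨x, hx, rfl, h⟩
    refine Finset.mem_coe.2 (Finset.mem_image_of_mem _ (mem_agreeing.2 ⟨hx, fun B hB hB' => ?_⟩))
    rw [h B hB (hYZ hB'), hz y hy B hB']
  rcases Nat.eq_zero_or_pos N with h0 | hpos
  · simp [h0]
  calc (N : ℝ≥0∞) ≤ (N : ℝ≥0∞) ^ ∑ i ∈ Finset.univ.filter (fun i => A ∈ X i), w i := by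
        conv_lhs => rw [← ENNReal.rpow_one (N : ℝ≥0∞)]
        exact ENNReal.rpow_le_rpow_of_exponent_le (by exact_mod_cast hpos) hA
    _ = ∏ i ∈ Finset.univ.filter (fun i => A ∈ X i), (N : ℝ≥0∞) ^ w i :=
        ENNReal.rpow_finsetSum_of_nonneg _ (fun i _ => hw i) _
    _ ≤ ∏ i ∈ Finset.univ.filter (fun i => A ∈ X i),
          ((agreeing (R i) Y y).card : ℝ≥0∞) ^ w i :=
        Finset.prod_le_prod' fun i hi => ENNReal.rpow_le_rpow
          (Nat.cast_le.2 (hNle i (Finset.mem_filter.1 hi).2)) (hw i)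
    _ ≤ ∏ i, ((agreeing (R i) Y y).card : ℝ≥0∞) ^ w i := by
        refine Finset.prod_le_prod_of_subset_of_one_le' (Finset.filter_subset _ _) fun i _ _ => ?_
        obtain ⟨x, hx, h⟩ := hy i
        have hcard : (1 : ℝ≥0∞) ≤ (agreeing (R i) Y y).card := by
          exact_mod_cast Finset.card_pos.2 ⟨x, mem_agreeing.2 ⟨hx, h⟩⟩
        simpa using ENNReal.rpow_le_rpow hcard (hw i)
end

section
/- Let Q(X) ← ⊗_{i=1..m} R_i(X_i) be a sum-product query over a commutative semiring K, let P be a pseudo-tree of Q, let A ∈ var(Q), and let x ∈ dom^{anc(A)} be arbitrary. Then ⟦Q[desc⁺(A)|x](out⁺(A))⟧ = ⊕_{a ∈ supp(⟦Q[{A}|x]⟧)} ( {a[X ∩ {A}] ↦ ⟦Q[{A}|x]⟧(a)} ⊗ ⊗_{B ∈ child(A)} ⟦Q[desc⁺(B)|(x,a)](out⁺(B))⟧ ), where the tensor of K-relations over pairwise disjoint variable sets U_1, U_2 is (R ⊗ S)(u) = R(u[U_1]) ⊗ S(u[U_2]) for u ∈ dom^{U_1 ∪ U_2}, and (x,a)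 denotes the tuple in dom^{anc⁺(A)} extending x by value a at A. -/
open scoped Classical

noncomputable section

/-- Closed ancestors in the rooted tree given by the parent function `par`. -/
def anccP {V : Type*} (par : V → V) (A : V) : Set V := {B | ∃ n : ℕ, par^[n] A = B}

/-- Proper ancestors. -/
def ancP {V : Type*} (par : V → V) (A : V) : Set V := anccP par A \ {A}

/-- Closed descendants. -/
def desccP {V : Type*} (par : V → V) (A : V) : Set V := {B | A ∈ anccP par B}

/-- Children of a node. -/
def childP {V : Type*} (par : V → V) (A : V) : Set V := {B | par B = A ∧ B ≠ A}

/-- The conditioned semantics `⟦Q[Z|y]⟧(z)` of the sum-product query with atoms `X i` and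
`K`-relations `R i` (relations are represented as functions on total tuples `V → dom`
that depend only on the coordinates in `X i`).  For disjoint `Y`, `Z`:
`⟦Q[Z|y]⟧(z) = ⊗_{i : ∅ ≠ X i∖Y ⊆ Z} R i ((y,z)[X i]) ⊗ ⊗_{other i} [∃ x ∈ supp (R i)
agreeing with (y,z) on X i ∩ (Y ∪ Z)]`. -/
def condSem {V dom K : Type*} [CommSemiring K] {m : ℕ}
    (X : Fin m → Set V) (R : Fin m → (V → dom) → K)
    (Y Z : Set V) (y z : V → dom) : K :=
  (∏ i : Fin m,
    if (X i \ Y).Nonempty ∧ X i \ Y ⊆ Z then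
      R i (fun A => if A ∈ Y then y A else z A)
    else 1) *
  (∏ i : Fin m,
    if (X i \ Y).Nonempty ∧ X i \ Y ⊆ Z then 1
    else if ∃ x : V → dom, R i x ≠ 0 ∧
        ∀ A ∈ X i ∩ (Y ∪ Z), x A = (if A ∈ Y then y A else z A) then (1 : K)
    else 0)

/-- The projected conditioned semantics `⟦Q[Z|y](Z')⟧(z')`, for `Z' ⊆ Z`: the sum of
`⟦Q[Z|y]⟧(z)` over tuples `z ∈ dom^Z` with `z[Z'] = z'`.  Tuples over `Z` are represented
canonically as total functions taking the default value `dflt` outside `Z`. -/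
def condSemProj {V dom K : Type*} [CommSemiring K] {m : ℕ}
    (X : Fin m → Set V) (R : Fin m → (V → dom) → K)
    (Y Z Z' : Set V) (y z' : V → dom) (dflt : dom) : K :=
  ∑ᶠ z ∈ {z : V → dom | (∀ A, A ∉ Z → z A = dflt) ∧ ∀ A ∈ Z', z A = z' A},
    condSem X R Y Z y z

end

/-! ### Rooted trees given by a parent function -/

theorem self_mem_anccP {V : Type*} (par : V → V) (A : V) : A ∈ anccP par A := ⟨0, rfl⟩

theorem anccP_trans {V : Type*} {par : V → V} {C D E : V} (hCD : C ∈ anccP par D)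
    (hDE : D ∈ anccP par E) : C ∈ anccP par E := by
  obtain ⟨n, rfl⟩ := hCD
  obtain ⟨k, rfl⟩ := hDE
  exact ⟨n + k, Function.iterate_add_apply par n k E⟩

theorem anccP_total {V : Type*} {par : V → V} {C D E : V} (hC : C ∈ anccP par E)
    (hD : D ∈ anccP par E) : C ∈ anccP par D ∨ D ∈ anccP par C := by
  obtain ⟨n, rfl⟩ := hC
  obtain ⟨k, rfl⟩ := hD
  rcases le_total n k with h | h
  · exact Or.inr ⟨k - n, by rw [← Function.iterate_add_apply, Nat.sub_add_cancel h]⟩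
  · exact Or.inl ⟨n - k, by rw [← Function.iterate_add_apply, Nat.sub_add_cancel h]⟩

theorem anccP_antisymm {V : Type*} {par : V → V} {root : V}
    (hT : par root = root ∧ ∀ A : V, ∃ n : ℕ, par^[n] A = root) {C D : V}
    (hCD : C ∈ anccP par D) (hDC : D ∈ anccP par C) : C = D := by
  obtain ⟨n, rfl⟩ := hCD
  obtain ⟨k, hk⟩ := hDC
  rcases Nat.eq_zero_or_pos n with rfl | hn
  · rfl
  obtain ⟨l, hl⟩ := hT.2 D
  have hper : Function.IsPeriodicPt par (k + n) D := by
    rw [Function.IsPeriodicPt, Function.IsFixedPt, Function.iterate_add_apply, hk]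
  have hle : l ≤ (k + n) * l := Nat.le_mul_of_pos_left l (by omega)
  have hroot : D = root := by
    rw [← (hper.mul_const l).eq, ← Nat.sub_add_cancel hle, Function.iterate_add_apply, hl]
    exact Function.iterate_fixed hT.1 _
  rw [hroot]
  exact Function.iterate_fixed hT.1 n

theorem disjoint_ancP_desccP {V : Type*} {par : V → V} {root : V}
    (hT : par root = root ∧ ∀ A : V, ∃ n : ℕ, par^[n] A = root) (A : V) :
    Disjoint (ancP par A) (desccP par A) :=
  Set.disjoint_left.2 fun _ h h' => h.2 (anccP_antisymm hT h.1 h')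

theorem mem_anccP_of_mem_childP {V : Type*} {par : V → V} {A B : V} (hB : B ∈ childP par A) :
    A ∈ anccP par B := ⟨1, hB.1⟩

theorem disjoint_anccP_desccP_of_mem_childP {V : Type*} {par : V → V} {root : V}
    (hT : par root = root ∧ ∀ A : V, ∃ n : ℕ, par^[n] A = root) {A B : V}
    (hB : B ∈ childP par A) : Disjoint (anccP par A) (desccP par B) :=
  Set.disjoint_left.2 fun _ h h' =>
    hB.2 (anccP_antisymm hT (anccP_trans h' h) (mem_anccP_of_mem_childP hB))

theorem desccP_subset_of_mem_childP {V : Type*} {par : V → V} {A B : V}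
    (hB : B ∈ childP par A) : desccP par B ⊆ desccP par A :=
  fun _ h => anccP_trans (mem_anccP_of_mem_childP hB) h

theorem exists_mem_childP_of_mem_desccP {V : Type*} {par : V → V} {A D : V}
    (hD : D ∈ desccP par A) (hne : D ≠ A) : ∃ B ∈ childP par A, D ∈ desccP par B := by
  obtain ⟨n, hn⟩ := hD
  induction n generalizing D with
  | zero => exact absurd hn hne
  | succ k ih =>
    rw [Function.iterate_succ_apply] at hn
    by_cases h : par D = A
    · exact ⟨D, ⟨h, hne⟩, self_mem_anccP par D⟩
    · obtain ⟨B, hB, hDB⟩ := ih h hn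
      exact ⟨B, hB, anccP_trans hDB ⟨1, rfl⟩⟩

theorem eq_of_mem_childP_of_mem_anccP {V : Type*} {par : V → V} {root : V}
    (hT : par root = root ∧ ∀ A : V, ∃ n : ℕ, par^[n] A = root) {A B B' : V}
    (hB : B ∈ childP par A) (hB' : B' ∈ childP par A) (h : B ∈ anccP par B') : B = B' := by
  by_contra hne
  obtain ⟨n, hn⟩ := h
  cases n with
  | zero => exact hne hn.symm
  | succ k =>
    rw [Function.iterate_succ_apply, hB'.1] at hn
    exact hB.2 (anccP_antisymm hT ⟨k, hn⟩ (mem_anccP_of_mem_childP hB))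

theorem childP_eq_of_mem_desccP {V : Type*} {par : V → V} {root : V}
    (hT : par root = root ∧ ∀ A : V, ∃ n : ℕ, par^[n] A = root) {A B B' D : V}
    (hB : B ∈ childP par A) (hB' : B' ∈ childP par A) (hD : D ∈ desccP par B)
    (hD' : D ∈ desccP par B') : B = B' := by
  rcases anccP_total hD hD' with h | h
  · exact eq_of_mem_childP_of_mem_anccP hT hB hB' h
  · exact (eq_of_mem_childP_of_mem_anccP hT hB' hB h).symm

/-- A set lying on a root-to-node path either avoids the subtree of `A`, or contains `A` and lies
on the path to `A`, or meets the subtree of exactly one child of `A`. -/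
theorem path_trichotomy {V : Type*} {par : V → V} {root : V}
    (hT : par root = root ∧ ∀ A : V, ∃ n : ℕ, par^[n] A = root) {C : V} {S : Set V}
    (hS : S ⊆ anccP par C) (A : V) :
    Disjoint S (desccP par A) ∨ (A ∈ S ∧ S ⊆ anccP par A) ∨
      ∃ B ∈ childP par A, (S ∩ desccP par B).Nonempty ∧ S ⊆ anccP par A ∪ desccP par B := by
  by_cases hd : Disjoint S (desccP par A)
  · exact Or.inl hd
  right
  obtain ⟨D, hDS, hDA⟩ := Set.not_disjoint_iff.1 hd
  have hcomp : ∀ E ∈ S, E ∈ anccP par A ∨ E ∈ desccP par A := fun E hE =>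
    anccP_total (hS hE) (anccP_trans hDA (hS hDS))
  by_cases hsub : S ⊆ anccP par A
  · exact Or.inl ⟨anccP_antisymm hT hDA (hsub hDS) ▸ hDS, hsub⟩
  obtain ⟨E, hES, hE⟩ := Set.not_subset.1 hsub
  obtain ⟨B, hB, hEB⟩ := exists_mem_childP_of_mem_desccP ((hcomp E hES).resolve_left hE)
    fun h => hE (h ▸ self_mem_anccP par A)
  refine Or.inr ⟨B, hB, ⟨E, hES, hEB⟩, fun F hF => ?_⟩
  by_cases hFA : F ∈ anccP par A
  · exact Or.inl hFA
  obtain ⟨B', hB', hFB'⟩ := exists_mem_childP_of_mem_desccP ((hcomp F hF).resolve_left hFA)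
    fun h => hFA (h ▸ self_mem_anccP par A)
  have hC : C ∈ desccP par B := anccP_trans hEB (hS hES)
  have hC' : C ∈ desccP par B' := anccP_trans hFB' (hS hF)
  exact Or.inr (childP_eq_of_mem_desccP hT hB hB' hC hC' ▸ hFB')

/-! ### Contribution of a single atom -/

/-- The factor contributed by a single atom to the conditioned semantics, where `w` is the total
tuple obtained by merging the condition with the argument. -/
noncomputable def atomSem {V dom K : Type*} [CommSemiring K] (S : Set V) (r : (V → dom) → K)
    (Y Z : Set V) (w : V → dom) : K :=
  if (S \ Y).Nonempty ∧ S \ Y ⊆ Z then r w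
  else if ∃ v, r v ≠ 0 ∧ ∀ A ∈ S ∩ (Y ∪ Z), v A = w A then 1 else 0

theorem condSem_eq_prod_atomSem {V dom K : Type*} [CommSemiring K] {m : ℕ}
    (X : Fin m → Set V) (R : Fin m → (V → dom) → K) (Y Z : Set V) (y z : V → dom) :
    condSem X R Y Z y z =
      ∏ i, atomSem (X i) (R i) Y Z (fun A => if A ∈ Y then y A else z A) := by
  rw [condSem, ← Finset.prod_mul_distrib]
  refine Finset.prod_congr rfl fun i _ => ?_
  unfold atomSem
  split_ifs <;> simp

theorem atomSem_congr {V dom K : Type*} [CommSemiring K] {S : Set V} {r : (V → dom) → K}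
    (hr : ∀ v w : V → dom, (∀ A ∈ S, v A = w A) → r v = r w) {Y Z : Set V} {w w' : V → dom}
    (h : ∀ A ∈ Y ∪ Z, w A = w' A) : atomSem S r Y Z w = atomSem S r Y Z w' := by
  unfold atomSem
  split_ifs with h₁ h₂ h₃ h₃
  · refine hr _ _ fun A hA => h A ?_
    by_cases hY : A ∈ Y
    · exact Or.inl hY
    · exact Or.inr (h₁.2 ⟨hA, hY⟩)
  · rfl
  · obtain ⟨v, hv, hvw⟩ := h₂
    exact absurd ⟨v, hv, fun A hA => (hvw A hA).trans (h A hA.2)⟩ h₃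
  · obtain ⟨v, hv, hvw⟩ := h₃
    exact absurd ⟨v, hv, fun A hA => (hvw A hA).trans (h A hA.2).symm⟩ h₂
  · rfl

theorem exists_of_atomSem_ne_zero {V dom K : Type*} [CommSemiring K] {S : Set V}
    {r : (V → dom) → K} {Y Z : Set V} {w : V → dom} (h : atomSem S r Y Z w ≠ 0) :
    ∃ v, r v ≠ 0 ∧ ∀ A ∈ S ∩ (Y ∪ Z), v A = w A := by
  unfold atomSem at h
  split_ifs at h with h₁ h₂
  · exact ⟨w, h, fun _ _ => rfl⟩
  · exact h₂
  · exact absurd rfl h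

theorem atomSem_decompose {V dom K : Type*} [CommSemiring K] [Fintype V] {S : Set V}
    {r : (V → dom) → K} (hr : ∀ v w : V → dom, (∀ A ∈ S, v A = w A) → r v = r w)
    {par : V → V} {root : V}
    (hT : par root = root ∧ ∀ A : V, ∃ n : ℕ, par^[n] A = root)
    (hS : ∃ C, S ⊆ anccP par C) (A : V) (w : V → dom) :
    atomSem S r (ancP par A) (desccP par A) w =
      atomSem S r (ancP par A) {A} w *
        ∏ B : childP par A, atomSem S r (anccP par A) (desccP par B) w := by
  obtain ⟨C, hC⟩ := hS
  have hYA : ancP par A ∪ {A} = anccP par A := by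
    rw [ancP, Set.sdiff_union_self, Set.union_eq_left, Set.singleton_subset_iff]
    exact self_mem_anccP par A
  have hA : A ∈ desccP par A := self_mem_anccP par A
  rcases path_trichotomy hT hC A with hd | ⟨hAS, hsub⟩ | ⟨B, hB, ⟨D, hDS, hDB⟩, hsub⟩
  · -- every factor is the same indicator
    have key : ∀ Y Z : Set V, Z ⊆ desccP par A → S ∩ (Y ∪ Z) = S ∩ ancP par A →
        atomSem S r Y Z w =
          if ∃ v, r v ≠ 0 ∧ ∀ A' ∈ S ∩ ancP par A, v A' = w A' then 1 else 0 := by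
      intro Y Z hZ hYZ
      rw [atomSem, if_neg, hYZ]
      rintro ⟨⟨D, hD⟩, hsub⟩
      exact Set.disjoint_left.1 hd hD.1 (hZ (hsub hD))
    have hAS : A ∉ S := fun h => Set.disjoint_left.1 hd h hA
    have hinter : ∀ Z ⊆ desccP par A, S ∩ (ancP par A ∪ Z) = S ∩ ancP par A := by
      intro Z hZ
      rw [Set.inter_union_distrib_left, (hd.mono_right hZ).inter_eq, Set.union_empty]
    have hsing : {A} ⊆ desccP par A := Set.singleton_subset_iff.2 hA
    rw [key _ _ subset_rfl (hinter _ subset_rfl), key _ _ hsing (hinter _ hsing),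
      Finset.prod_congr rfl fun (B : childP par A) _ => key (anccP par A) (desccP par B)
        (desccP_subset_of_mem_childP B.2) (by
          rw [← hYA, Set.union_assoc]
          exact hinter _ (Set.union_subset hsing (desccP_subset_of_mem_childP B.2)))]
    split_ifs <;> simp
  · have hdiff : S \ ancP par A = {A} := by
      ext D
      constructor
      · rintro ⟨hD, hD'⟩
        by_contra hne
        exact hD' ⟨hsub hD, hne⟩
      · rintro rfl
        exact ⟨hAS, fun h => h.2 rfl⟩
    have hdiff' : S \ anccP par A = ∅ := Set.sdiff_eq_empty.2 hsub
    have hind : ∀ B : childP par A, atomSem S r (anccP par A) (desccP par B) w =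
        if r w ≠ 0 then 1 else 0 := by
      intro B
      rw [atomSem, hdiff', if_neg (by simp)]
      refine if_congr ⟨?_, fun h => ⟨w, h, fun _ _ => rfl⟩⟩ rfl rfl
      rintro ⟨v, hv, hvw⟩
      rwa [← hr v w fun D hD => hvw D ⟨hD, Or.inl (hsub hD)⟩]
    rw [Finset.prod_congr rfl fun B _ => hind B, atomSem, atomSem, hdiff,
      if_pos ⟨Set.singleton_nonempty A, Set.singleton_subset_iff.2 hA⟩,
      if_pos ⟨Set.singleton_nonempty A, subset_rfl⟩]
    by_cases h : r w = 0 <;> simp [h]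
  · have hDA : D ∉ anccP par A := fun h =>
      Set.disjoint_left.1 (disjoint_anccP_desccP_of_mem_childP hT hB) h hDB
    have hfull : atomSem S r (ancP par A) (desccP par A) w = r w := by
      rw [atomSem, if_pos]
      refine ⟨⟨D, hDS, fun h => hDA h.1⟩, ?_⟩
      rintro E ⟨hES, hE⟩
      rcases hsub hES with h | h
      · by_cases hEA : E = A
        · exact hEA ▸ hA
        · exact absurd ⟨h, hEA⟩ hE
      · exact desccP_subset_of_mem_childP hB h
    have hpart : atomSem S r (anccP par A) (desccP par B) w = r w := by
      rw [atomSem, if_pos]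
      exact ⟨⟨D, hDS, hDA⟩, fun E hE => (hsub hE.1).resolve_left hE.2⟩
    rw [hfull]
    by_cases h : r w = 0
    · rw [Finset.prod_eq_zero (Finset.mem_univ (⟨B, hB⟩ : childP par A)) (hpart.trans h),
        mul_zero, h]
    · have hone : ∀ Y Z : Set V, D ∉ Y → D ∉ Z → atomSem S r Y Z w = 1 := by
        intro Y Z hY hZ
        rw [atomSem, if_neg fun h' => hZ (h'.2 ⟨hDS, hY⟩), if_pos ⟨w, h, fun _ _ => rfl⟩]
      rw [hone (ancP par A) {A} (fun h' => hDA h'.1)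
        (fun h' => hDA (Set.mem_singleton_iff.1 h' ▸ self_mem_anccP par A)), one_mul,
        Finset.prod_eq_single (⟨B, hB⟩ : childP par A), hpart]
      · intro B' _ hne
        exact hone _ _ hDA fun h' =>
          hne (Subtype.ext (childP_eq_of_mem_desccP hT B'.2 hB h' hDB))
      · exact fun h' => absurd (Finset.mem_univ _) h'

/-! ### Reduction to finite sums -/

/-- The values taken by the supports of the relations. -/
def activeDomain {V dom K : Type*} [Zero K] {m : ℕ} (X : Fin m → Set V)
    (R : Fin m → (V → dom) → K) : Set dom :=
  {d | ∃ i, ∃ A ∈ X i, ∃ v, R i v ≠ 0 ∧ v A = d}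

theorem finite_activeDomain {V dom K : Type*} [CommSemiring K] [Fintype V] {dflt : dom} {m : ℕ}
    {X : Fin m → Set V} {R : Fin m → (V → dom) → K}
    (hdep : ∀ (i : Fin m) (v w : V → dom), (∀ A ∈ X i, v A = w A) → R i v = R i w)
    (hfin : ∀ i, {v : V → dom | R i v ≠ 0 ∧ ∀ A, A ∉ X i → v A = dflt}.Finite) :
    (activeDomain X R).Finite := by
  refine (Set.finite_iUnion fun i => Set.finite_iUnion fun A : V =>
    (hfin i).image fun v => v A).subset ?_
  rintro d ⟨i, A, hA, v, hv, rfl⟩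
  refine Set.mem_iUnion₂.2 ⟨i, A, fun B => if B ∈ X i then v B else dflt, ⟨?_, ?_⟩, if_pos hA⟩
  · rwa [hdep i _ v fun B hB => if_pos hB]
  · exact fun B hB => if_neg hB

theorem mem_activeDomain_of_condSem_ne_zero {V dom K : Type*} [CommSemiring K] {m : ℕ}
    {X : Fin m → Set V} {R : Fin m → (V → dom) → K} (hvar : ∀ A : V, ∃ i, A ∈ X i)
    {Y Z : Set V} {y z : V → dom} (h : condSem X R Y Z y z ≠ 0) {C : V} (hZ : C ∈ Z)
    (hY : C ∉ Y) : z C ∈ activeDomain X R := by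
  rw [condSem_eq_prod_atomSem] at h
  obtain ⟨i, hi⟩ := hvar C
  obtain ⟨v, hv, hvw⟩ := exists_of_atomSem_ne_zero
    (fun h' => h (Finset.prod_eq_zero (Finset.mem_univ i) h'))
  exact ⟨i, C, hi, v, hv, (hvw C ⟨hi, Or.inr hZ⟩).trans (if_neg hY)⟩

/-- The finite box of tuples over `Z` with entries in `S`, extended by `dflt`. -/
noncomputable def tupleBox {V dom : Type*} [Fintype V] (S : V → Finset dom) (Z : Set V) (dflt : dom) :
    Finset (V → dom) :=
  Fintype.piFinset fun C => if C ∈ Z then S C else {dflt}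

theorem mem_tupleBox {V dom : Type*} [Fintype V] {S : V → Finset dom} {Z : Set V} {dflt : dom}
    {z : V → dom} :
    z ∈ tupleBox S Z dflt ↔ (∀ C ∈ Z, z C ∈ S C) ∧ ∀ C, C ∉ Z → z C = dflt := by
  rw [tupleBox, Fintype.mem_piFinset]
  constructor
  · exact fun h => ⟨fun C hC => by simpa [hC] using h C, fun C hC => by simpa [hC] using h C⟩
  · rintro ⟨h₁, h₂⟩ C
    by_cases hC : C ∈ Z
    · simpa [hC] using h₁ C hC
    · simpa [hC] using h₂ C hC

theorem condSemProj_eq_sum_tupleBox {V dom K : Type*} [CommSemiring K] [Fintype V] {dflt : dom}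
    {m : ℕ} {X : Fin m → Set V} {R : Fin m → (V → dom) → K}
    (hvar : ∀ A : V, ∃ i, A ∈ X i) {Xout : Set V} {u : V → dom} {S : V → Finset dom}
    (hS : ∀ C d, d ∈ S C ↔ d ∈ activeDomain X R ∧ (C ∈ Xout → d = u C))
    {Y Z : Set V} (hYZ : Disjoint Y Z) (y : V → dom) :
    condSemProj X R Y Z (Z ∩ Xout) y u dflt =
      ∑ z ∈ tupleBox S Z dflt, condSem X R Y Z y z := by
  refine finsum_mem_eq_sum_of_inter_support_eq _ ?_
  ext z
  simp only [Set.mem_inter_iff, Set.mem_ofPred_eq, Function.mem_support, Finset.mem_coe,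
    mem_tupleBox, hS]
  constructor
  · rintro ⟨⟨h₁, h₂⟩, h⟩
    exact ⟨⟨fun C hC => ⟨mem_activeDomain_of_condSem_ne_zero hvar h hC
      (Set.disjoint_right.1 hYZ hC), fun hX => h₂ C ⟨hC, hX⟩⟩, h₁⟩, h⟩
  · rintro ⟨⟨h₁, h₂⟩, h⟩
    exact ⟨⟨h₂, fun C hC => (h₁ C hC.1).2 hC.2⟩, h⟩

/-- Summing over a box on the subtree of `A` amounts to summing over the value at `A` and over
boxes on the subtrees of the children of `A`. -/
theorem sum_tupleBox_desccP {V dom K : Type*} [CommSemiring K] [Fintype V] {dflt : dom}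
    {par : V → V} {root : V}
    (hT : par root = root ∧ ∀ A : V, ∃ n : ℕ, par^[n] A = root) (S : V → Finset dom) (A : V)
    (f : (V → dom) → K) (c : dom → K) (g : dom → childP par A → (V → dom) → K)
    (h : ∀ z, f z = c (z A) *
      ∏ B : childP par A, g (z A) B (fun C => if C ∈ desccP par B then z C else dflt)) :
    ∑ z ∈ tupleBox S (desccP par A) dflt, f z =
      ∑ a ∈ S A, c a *
        ∏ B : childP par A, ∑ z ∈ tupleBox S (desccP par B) dflt, g a B z := by
  simp_rw [Finset.prod_univ_sum, Finset.mul_sum]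
  rw [← Finset.sum_product'
    (f := fun a (p : childP par A → V → dom) => c a * ∏ B, g a B (p B))]
  have hAB : ∀ B : childP par A, A ∉ desccP par B := fun B hA =>
    Set.disjoint_left.1 (disjoint_anccP_desccP_of_mem_childP hT B.2) (self_mem_anccP par A) hA
  refine Finset.sum_nbij'
    (fun z => (z A, fun B C => if C ∈ desccP par B then z C else dflt))
    (fun q C => if C = A then q.1 else
      if h : ∃ B : childP par A, C ∈ desccP par B then q.2 h.choose C else dflt)
    ?_ ?_ ?_ ?_ fun z _ => h z
  · intro z hz
    rw [mem_tupleBox] at hz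
    rw [Finset.mem_product, Fintype.mem_piFinset]
    refine ⟨hz.1 A (self_mem_anccP par A), fun B => mem_tupleBox.2 ⟨fun C hC => ?_, ?_⟩⟩
    · simpa [hC] using hz.1 C (desccP_subset_of_mem_childP B.2 hC)
    · exact fun C hC => if_neg hC
  · rintro ⟨a, p⟩ hq
    rw [Finset.mem_product, Fintype.mem_piFinset] at hq
    refine mem_tupleBox.2 ⟨fun C hC => ?_, fun C hC => ?_⟩
    · by_cases hCA : C = A
      · subst hCA
        simpa using hq.1
      · obtain ⟨B, hB, hCB⟩ := exists_mem_childP_of_mem_desccP hC hCA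
        have hex : ∃ B : childP par A, C ∈ desccP par B := ⟨⟨B, hB⟩, hCB⟩
        rw [if_neg hCA, dif_pos hex]
        exact (mem_tupleBox.1 (hq.2 hex.choose)).1 C hex.choose_spec
    · rw [if_neg (fun h' : C = A => hC (h' ▸ self_mem_anccP par A)), dif_neg]
      rintro ⟨B, hB⟩
      exact hC (desccP_subset_of_mem_childP B.2 hB)
  · intro z hz
    rw [mem_tupleBox] at hz
    funext C
    by_cases hCA : C = A
    · simp [hCA]
    · by_cases hex : ∃ B : childP par A, C ∈ desccP par B
      · simp only [if_neg hCA, dif_pos hex, if_pos hex.choose_spec]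
      · simp only [if_neg hCA, dif_neg hex]
        refine (hz.2 C fun hC => hex ?_).symm
        obtain ⟨B, hB, hCB⟩ := exists_mem_childP_of_mem_desccP hC hCA
        exact ⟨⟨B, hB⟩, hCB⟩
  · rintro ⟨a, p⟩ hq
    rw [Finset.mem_product, Fintype.mem_piFinset] at hq
    refine Prod.ext (if_pos rfl) (funext fun B => funext fun C => ?_)
    by_cases hC : C ∈ desccP par B
    · have hex : ∃ B : childP par A, C ∈ desccP par B := ⟨B, hC⟩
      have hch : hex.choose = B :=
        Subtype.ext (childP_eq_of_mem_desccP hT hex.choose.2 B.2 hex.choose_spec hC)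
      have hCA : C ≠ A := fun h' => hAB B (h' ▸ hC)
      simp only [if_pos hC, if_neg hCA, dif_pos hex, hch]
    · simp only [if_neg hC]
      exact ((mem_tupleBox.1 (hq.2 B)).2 C hC).symm

/-- Pointwise form of the decomposition, before summation. -/
theorem condSem_decompose {V dom K : Type*} [CommSemiring K] [Fintype V] [DecidableEq V]
    {dflt : dom} {m : ℕ} {X : Fin m → Set V} {R : Fin m → (V → dom) → K}
    (hdep : ∀ (i : Fin m) (v w : V → dom), (∀ A ∈ X i, v A = w A) → R i v = R i w)
    {par : V → V} {root : V}
    (hT : par root = root ∧ ∀ A : V, ∃ n : ℕ, par^[n] A = root)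
    (hPT : ∀ i, ∃ A : V, X i ⊆ anccP par A) (A : V) (x z : V → dom) :
    condSem X R (ancP par A) (desccP par A) x z =
      condSem X R (ancP par A) {A} x (fun _ => z A) *
        ∏ B : childP par A, condSem X R (anccP par A) (desccP par B)
          (Function.update x A (z A)) (fun C => if C ∈ desccP par B then z C else dflt) := by
  simp_rw [condSem_eq_prod_atomSem]
  rw [Finset.prod_comm, ← Finset.prod_mul_distrib]
  refine Finset.prod_congr rfl fun i _ => ?_
  rw [atomSem_decompose (hdep i) hT (hPT i)]
  congr 1
  · refine atomSem_congr (hdep i) ?_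
    rintro C (hC | rfl)
    · simp [hC]
    · simp
  · refine Finset.prod_congr rfl fun B _ => atomSem_congr (hdep i) ?_
    intro C hC
    by_cases hCA : C = A
    · subst hCA
      simp [ancP, self_mem_anccP]
    · by_cases hCY : C ∈ anccP par A
      · simp [ancP, hCY, hCA]
      · simp [ancP, hCY, hC.resolve_left hCY]

/-- correctness identity behind the pseudo-tree algorithm, Lemma
`app:ptdecompose`.  For a sum-product query `Q(Xout) ← ⊗_i R i (X i)` over a commutative
semiring `K` (variables `V = var(Q)` finite, `dom` infinite, relations depending only on
their attributes and of finite support), a pseudo-tree given by `(root, par)`, a variable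
`A`, and any `x ∈ dom^{anc(A)}`:
`⟦Q[desc⁺(A)|x](out⁺(A))⟧ = ⊕_{a ∈ supp ⟦Q[{A}|x]⟧} ({a[Xout ∩ {A}] ↦ ⟦Q[{A}|x]⟧(a)}
  ⊗ ⊗_{B ∈ child(A)} ⟦Q[desc⁺(B)|(x,a)](out⁺(B))⟧)`,
as an equality of `K`-relations over `out⁺(A)` (i.e. evaluated at every `u`). -/
theorem stmt_2 {V dom K : Type*} [CommSemiring K] [Fintype V] [DecidableEq V]
    [Infinite dom] (dflt : dom)
    {m : ℕ} (X : Fin m → Set V) (Xout : Set V)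
    (R : Fin m → (V → dom) → K)
    (hdep : ∀ (i : Fin m) (v w : V → dom), (∀ A ∈ X i, v A = w A) → R i v = R i w)
    (hfin : ∀ i, {v : V → dom | R i v ≠ 0 ∧ ∀ A, A ∉ X i → v A = dflt}.Finite)
    (hvar : ∀ A : V, ∃ i, A ∈ X i)
    (root : V) (par : V → V)
    (hT : par root = root ∧ ∀ A : V, ∃ n : ℕ, par^[n] A = root)
    (hPT : ∀ i, ∃ A : V, X i ⊆ anccP par A)
    (A : V) (x : V → dom) :
    ∀ u : V → dom,
      condSemProj X R (ancP par A) (desccP par A) (desccP par A ∩ Xout) x u dflt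
        = ∑ᶠ a : dom,
            (if A ∈ Xout then
              (if u A = a then condSem X R (ancP par A) {A} x (fun _ => a) else 0)
            else condSem X R (ancP par A) {A} x (fun _ => a)) *
            ∏ᶠ B ∈ childP par A,
              condSemProj X R (anccP par A) (desccP par B) (desccP par B ∩ Xout)
                (Function.update x A a) u dflt := by
  intro u
  set S : V → Finset dom := fun C =>
    (finite_activeDomain hdep hfin).toFinset.filter fun d => C ∈ Xout → d = u C with hSdef
  have hS : ∀ C d, d ∈ S C ↔ d ∈ activeDomain X R ∧ (C ∈ Xout → d = u C) := by
    simp [hSdef]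
  have hprod : ∀ a : dom,
      (∏ᶠ B ∈ childP par A, condSemProj X R (anccP par A) (desccP par B) (desccP par B ∩ Xout)
        (Function.update x A a) u dflt) =
      ∏ B : childP par A, ∑ z ∈ tupleBox S (desccP par B) dflt,
        condSem X R (anccP par A) (desccP par B) (Function.update x A a) z := by
    intro a
    rw [← finprod_set_coe_eq_finprod_mem, finprod_eq_prod_of_fintype]
    exact Finset.prod_congr rfl fun B _ => condSemProj_eq_sum_tupleBox hvar hS
      (disjoint_anccP_desccP_of_mem_childP hT B.2) _
  simp_rw [hprod]
  rw [condSemProj_eq_sum_tupleBox hvar hS (disjoint_ancP_desccP hT A),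
    sum_tupleBox_desccP hT S A _ (fun a => condSem X R (ancP par A) {A} x fun _ => a)
      (fun a B => condSem X R (anccP par A) (desccP par B) (Function.update x A a))
      fun z => condSem_decompose hdep hT hPT A x z,
    finsum_eq_sum_of_support_subset (s := S A)]
  · refine Finset.sum_congr rfl fun a ha => ?_
    congr 1
    by_cases hA : A ∈ Xout
    · rw [if_pos hA, if_pos (((hS A a).1 ha).2 hA).symm]
    · rw [if_neg hA]
  · intro a ha
    have h := left_ne_zero_of_mul (Function.mem_support.1 ha)
    have hne : condSem X R (ancP par A) {A} x (fun _ => a) ≠ 0 := by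
      split_ifs at h <;> first | exact h | exact absurd rfl h
    refine (hS A a).2 ⟨mem_activeDomain_of_condSem_ne_zero hvar hne rfl fun h' => h'.2 rfl,
      fun hA => ?_⟩
    by_contra hau
    exact h (by rw [if_pos hA, if_neg (Ne.symm hau)])
end

section
/- Let ℓ ≥ 2 be an integer and k = 2ℓ. Let Q be the triple k-clique query hypergraph with variables A_1, …, A_{2k} whose atoms are exactly the pairs {A_i, A_j} with i < j and either both i, j ∈ [1, k], or both i, j ∈ [k−ℓ+1, k+ℓ], or both i, j ∈ [k+1, 2k]. Then ρ*({A_1, …, A_{2k}}) = k. -/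
open scoped Classical

noncomputable section

/-- The fractional edge cover number `ρ*(Y)` of a set `Y` of variables, with respect to the
atoms `X i` (each a finite set of variables). -/
def rhoStar {V ι : Type*} [Fintype ι] [DecidableEq V]
    (X : ι → Finset V) (Y : Set V) : ℝ :=
  sInf {r : ℝ | ∃ w : ι → ℝ, (∀ i, 0 ≤ w i) ∧
    (∀ A ∈ Y, 1 ≤ ∑ i ∈ Finset.univ.filter (fun i => A ∈ X i), w i) ∧ r = ∑ i, w i}

/-- Closed ancestors `anc⁺(A)` in the rooted tree given by the parent function `par`. -/
def ancc {V : Type*} (par : V → V) (A : V) : Set V := {B | ∃ n : ℕ, par^[n] A = B}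

/-- Proper ancestors `anc(A)`. -/
def anc {V : Type*} (par : V → V) (A : V) : Set V := ancc par A \ {A}

/-- Closed descendants `desc⁺(A)`. -/
def descc {V : Type*} (par : V → V) (A : V) : Set V := {B | A ∈ ancc par B}

/-- Proper descendants `desc(A)`. -/
def descO {V : Type*} (par : V → V) (A : V) : Set V := {B | A ∈ anc par B}

/-- `(root, par)` describes a rooted tree: the root is a fixed point of the parent map and
every node reaches the root by iterating the parent map. -/
def IsRootedTree {V : Type*} (root : V) (par : V → V) : Prop :=
  par root = root ∧ ∀ A : V, ∃ n : ℕ, par^[n] A = root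

/-- The rooted tree given by `par` is a pseudo-tree of the query with atoms `X`:
every atom is contained in some branch. -/
def IsPseudoTree {V ι : Type*} (X : ι → Finset V) (par : V → V) : Prop :=
  ∀ i, ∃ A : V, (X i : Set V) ⊆ ancc par A

/-- Space exponent `s(P)` of a pseudo-tree. -/
def sExp {V ι : Type*} [Fintype V] [Fintype ι] [DecidableEq V]
    (X : ι → Finset V) (Xout : Set V) (par : V → V) : ℝ :=
  ⨆ A : V, rhoStar X (descc par A ∩ Xout)

/-- Time exponent `t(P)` of a pseudo-tree. -/
def tExp {V ι : Type*} [Fintype V] [Fintype ι] [DecidableEq V]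
    (X : ι → Finset V) (Xout : Set V) (par : V → V) : ℝ :=
  ⨆ A : V, rhoStar X (ancc par A ∪ (descO par A ∩ Xout))

/-- `(root, par, χ)` is a tree decomposition of the query with atoms `X` and output
variables `Xout`: the output variables are contained in the root bag, for every variable
the set of bags containing it is connected (expressed via a common ancestor `t` whose
paths down to the two given bags are fully covered), and every atom is covered by a bag. -/
def IsTreeDecomp {V ν ι : Type*} (X : ι → Finset V) (Xout : Set V)
    (root : ν) (par : ν → ν) (χ : ν → Set V) : Prop :=
  Xout ⊆ χ root ∧
  (∀ (A : V) (v w : ν), A ∈ χ v → A ∈ χ w →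
    ∃ t : ν, A ∈ χ t ∧ t ∈ ancc par v ∧ t ∈ ancc par w ∧
      (∀ u : ν, u ∈ ancc par v → t ∈ ancc par u → A ∈ χ u) ∧
      (∀ u : ν, u ∈ ancc par w → t ∈ ancc par u → A ∈ χ u)) ∧
  (∀ i, ∃ v : ν, (X i : Set V) ⊆ χ v)

/-- The `TD(GJ)` space exponent of a tree decomposition:
`max(ρ*(X), max over tree edges (u,v) of ρ*(χ(u) ∩ χ(v)))`. -/
def tdSpace {V ν ι : Type*} [Fintype ν] [Fintype ι] [DecidableEq V]
    (X : ι → Finset V) (Xout : Set V) (root : ν) (par : ν → ν) (χ : ν → Set V) : ℝ :=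
  max (rhoStar X Xout) (⨆ v : {v : ν // v ≠ root}, rhoStar X (χ (par v.1) ∩ χ v.1))

/-- The `TD(GJ)` time exponent of a tree decomposition: `max_v ρ*(χ(v))`. -/
def tdTime {V ν ι : Type*} [Fintype ν] [Fintype ι] [DecidableEq V]
    (X : ι → Finset V) (χ : ν → Set V) : ℝ :=
  ⨆ v : ν, rhoStar X (χ v)

/-- The fractional hypertree width: the infimum of `max_v ρ*(χ(v))` over all (finite)
tree decompositions, encoded with node sets `Fin n`. -/
def fhw {V ι : Type*} [Fintype V] [Fintype ι] [DecidableEq V]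
    (X : ι → Finset V) (Xout : Set V) : ℝ :=
  sInf {r : ℝ | ∃ (n : ℕ) (root : Fin n) (par : Fin n → Fin n) (χ : Fin n → Set V),
    IsRootedTree root par ∧ IsTreeDecomp X Xout root par χ ∧ r = tdTime X χ}

/-- The context `con(A)` of a variable in a pseudo-tree: those proper ancestors `B` of `A`
that share an atom with some closed descendant of `A`. -/
def conSet {V ι : Type*} (X : ι → Finset V) (par : V → V) (A : V) : Set V :=
  {B | B ∈ anc par A ∧ ∃ C ∈ descc par A, ∃ i, B ∈ X i ∧ C ∈ X i}

/-- `B_A`: the deepest cached closed ancestor of `A` (the element of `C ∩ anc⁺(A)` of which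
all other elements of `C ∩ anc⁺(A)` are closed ancestors). -/
def lowestCache {V : Type*} (par : V → V) (C : Set V) (A : V) : V :=
  if h : ∃ B, (B ∈ C ∩ ancc par A) ∧ C ∩ ancc par A ⊆ ancc par B then h.choose else A

/-- Space exponent of a pseudo-tree with caching `(P, C)`. -/
def sPTC {V ι : Type*} [Fintype V] [Fintype ι] [DecidableEq V]
    (X : ι → Finset V) (Xout : Set V) (par : V → V) (C : Set V) : ℝ :=
  ⨆ A : ↥C, rhoStar X (conSet X par A.1 ∪ (descc par A.1 ∩ Xout))

/-- Time exponent of a pseudo-tree with caching `(P, C)`: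
`max_A ρ*(con(B_A) ∪ [A, B_A] ∪ out(A))`. -/
def tPTC {V ι : Type*} [Fintype V] [Fintype ι] [DecidableEq V]
    (X : ι → Finset V) (Xout : Set V) (par : V → V) (C : Set V) : ℝ :=
  ⨆ A : V, rhoStar X (conSet X par (lowestCache par C A)
    ∪ {u | u ∈ ancc par A ∧ lowestCache par C A ∈ ancc par u}
    ∪ (descO par A ∩ Xout))

/-- Depth of a node in the rooted tree. -/
def tdepth {V : Type*} (root : V) (par : V → V) (A : V) : ℕ :=
  sInf {n : ℕ | par^[n] A = root}

/-- The stored context `scon(A)` of a PTCR `(P, C)`: the `min(C A, |con(A)|)` deepest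
elements of `con(A)`. -/
def sconSet {V ι : Type*} (X : ι → Finset V) (root : V) (par : V → V)
    (Csize : V → ℕ) (A : V) : Set V :=
  {B | B ∈ conSet X par A ∧
    Set.ncard {B' | B' ∈ conSet X par A ∧ tdepth root par B < tdepth root par B'}
      < min (Csize A) (conSet X par A).ncard}

/-- The instantiated context `icon(A)` of a PTCR `(P, C)`. -/
def iconSet {V ι : Type*} (X : ι → Finset V) (root : V) (par : V → V)
    (Csize : V → ℕ) (A : V) : Set V :=
  conSet X par A \ sconSet X root par Csize A

/-- Space exponent of a PTCR: `max_A ρ*(scon(A) ∪ out⁺(A))`. -/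
def sPTCR {V ι : Type*} [Fintype V] [Fintype ι] [DecidableEq V]
    (X : ι → Finset V) (Xout : Set V) (root : V) (par : V → V) (Csize : V → ℕ) : ℝ :=
  ⨆ A : V, rhoStar X (sconSet X root par Csize A ∪ (descc par A ∩ Xout))

/-- Time exponent of a PTCR: `max_A ρ*(ra(A) ∪ out(A))`, where the relevant-ancestor
function `ra` is supplied (it is determined by its defining top-down recurrence). -/
def tPTCR {V ι : Type*} [Fintype V] [Fintype ι] [DecidableEq V]
    (X : ι → Finset V) (Xout : Set V) (par : V → V) (ra : V → Set V) : ℝ :=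
  ⨆ A : V, rhoStar X (ra A ∪ (descO par A ∩ Xout))

end

/-- If every atom has at most two variables, then every fractional edge cover of all variables
has weight at least half the number of variables. -/
theorem card_le_two_mul_sum_of_cover {V ι : Type*} [Fintype V] [Fintype ι] [DecidableEq V]
    {X : ι → Finset V} (hX : ∀ i, (X i).card ≤ 2) {w : ι → ℝ} (hw : ∀ i, 0 ≤ w i)
    (hcover : ∀ A, 1 ≤ ∑ i ∈ Finset.univ.filter (fun i => A ∈ X i), w i) :
    (Fintype.card V : ℝ) ≤ 2 * ∑ i, w i := by
  calc (Fintype.card V : ℝ) = ∑ _A : V, (1 : ℝ) := by simp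
    _ ≤ ∑ A : V, ∑ i ∈ Finset.univ.filter (fun i => A ∈ X i), w i :=
        Finset.sum_le_sum fun A _ => hcover A
    _ = ∑ i, ((X i).card : ℝ) * w i := by
        simp_rw [Finset.sum_filter]
        rw [Finset.sum_comm]
        refine Finset.sum_congr rfl fun i _ => ?_
        rw [← Finset.sum_filter]
        simp
    _ ≤ ∑ i, 2 * w i := Finset.sum_le_sum fun i _ =>
        mul_le_mul_of_nonneg_right (by exact_mod_cast hX i) (hw i)
    _ = 2 * ∑ i, w i := by rw [Finset.mul_sum]

/-- If every atom has at most two variables and a family of atoms indexed by `κ`, with half as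
many members as there are variables, covers all variables, then the fractional edge cover number
is the size of that family. -/
theorem rhoStar_univ_eq_card_of_cover {V ι κ : Type*} [Fintype V] [Fintype ι] [Fintype κ]
    [DecidableEq V] {X : ι → Finset V} (hX : ∀ i, (X i).card ≤ 2) (e : κ → ι)
    (he : ∀ A, ∃ j, A ∈ X (e j)) (hcard : Fintype.card V = 2 * Fintype.card κ) :
    rhoStar X Set.univ = Fintype.card κ := by
  have lower : ∀ w : ι → ℝ, (∀ i, 0 ≤ w i) →
      (∀ A ∈ Set.univ, 1 ≤ ∑ i ∈ Finset.univ.filter (fun i => A ∈ X i), w i) →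
      (Fintype.card κ : ℝ) ≤ ∑ i, w i := by
    intro w hw hcover
    have h := card_le_two_mul_sum_of_cover hX hw fun A => hcover A trivial
    rw [hcard] at h
    push_cast at h
    linarith
  let w : ι → ℝ := fun i => if i ∈ Finset.univ.image e then 1 else 0
  have hw : ∀ i, 0 ≤ w i := fun i => by dsimp only [w]; split_ifs <;> norm_num
  have hcover : ∀ A ∈ Set.univ, 1 ≤ ∑ i ∈ Finset.univ.filter (fun i => A ∈ X i), w i := by
    intro A _
    obtain ⟨j, hj⟩ := he A
    calc (1 : ℝ) = w (e j) := by simp [w]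
      _ ≤ _ := Finset.single_le_sum (fun i _ => hw i) (by simpa using hj)
  have hsum : ∑ i, w i ≤ Fintype.card κ := by
    have h : ∑ i, w i = ((Finset.univ.image e).card : ℝ) := by
      simp only [w, Finset.sum_boole, Finset.filter_univ_mem]
    rw [h]
    exact_mod_cast Finset.card_image_le
  refine le_antisymm ?_ ?_
  · refine le_trans (csInf_le ⟨(Fintype.card κ : ℝ), ?_⟩ ⟨w, hw, hcover, rfl⟩) hsum
    rintro r ⟨w', hw', hcover', rfl⟩
    exact lower w' hw' hcover'
  · refine le_csInf ⟨_, w, hw, hcover, rfl⟩ ?_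
    rintro r ⟨w', hw', hcover', rfl⟩
    exact lower w' hw' hcover'

/-- The triple `k`-clique query (`k = 2ℓ`, `ℓ ≥ 2`): variables are
`Fin (2k)` (0-indexed, variable `A_{i+1}` is index `i`), and the atoms are exactly the
pairs `{i, j}` with `i < j` lying both in `[0, k)`, both in `[k−ℓ, k+ℓ)`, or both in
`[k, 2k)`.  Its fractional edge cover number is `k`. -/
theorem stmt_7 (ℓ : ℕ) (hℓ : 2 ≤ ℓ) (k : ℕ) (hk : k = 2 * ℓ) :
    rhoStar
      (ι := {p : Fin (2 * k) × Fin (2 * k) //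
        p.1.val < p.2.val ∧
          ((p.1.val < k ∧ p.2.val < k) ∨
           (k - ℓ ≤ p.1.val ∧ p.1.val < k + ℓ ∧ k - ℓ ≤ p.2.val ∧ p.2.val < k + ℓ) ∨
           (k ≤ p.1.val ∧ k ≤ p.2.val))})
      (fun p => {p.1.1, p.1.2}) Set.univ = (k : ℝ) := by
  have h := rhoStar_univ_eq_card_of_cover
    (ι := {p : Fin (2 * k) × Fin (2 * k) //
      p.1.val < p.2.val ∧
        ((p.1.val < k ∧ p.2.val < k) ∨
         (k - ℓ ≤ p.1.val ∧ p.1.val < k + ℓ ∧ k - ℓ ≤ p.2.val ∧ p.2.val < k + ℓ) ∨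
         (k ≤ p.1.val ∧ k ≤ p.2.val))})
    (X := fun p => {p.1.1, p.1.2}) (κ := Fin k) (fun _ => Finset.card_le_two)
    (fun j => ⟨(⟨2 * j.val, by omega⟩, ⟨2 * j.val + 1, by omega⟩),
      by dsimp only; omega⟩)
    (fun A => ⟨⟨A.val / 2, by omega⟩, by
      simp only [Finset.mem_insert, Finset.mem_singleton, Fin.ext_iff]
      omega⟩)
    (by simp)
  simpa only [Fintype.card_fin] using h
end

section
/- Let Q₄ be the scalar 4-path query hypergraph with variables V = {A, B, C, D}, atoms {A,B}, {B,C}, {C,D}, and output variables X = ∅. Then: (i) the path-shaped tree with three nodes whose bags are {A,B}, {B,C}, {C,D} (in this order, rooted at the node with bag {A,B}) is a tree decomposition of Q₄ with TD(GJ) space exponent 1 and TD(GJ) time exponent 1; and (ii) every pseudo-tree P of Q₄ has t(P) ≥ 2. -/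
open scoped Classical

theorem rhoStar_le_sum {V ι : Type*} [Fintype ι] [DecidableEq V] (X : ι → Finset V) {Y : Set V}
    (w : ι → ℝ) (hw : ∀ i, 0 ≤ w i)
    (hY : ∀ A ∈ Y, 1 ≤ ∑ i ∈ Finset.univ.filter (fun i => A ∈ X i), w i) :
    rhoStar X Y ≤ ∑ i, w i := by
  refine csInf_le ⟨0, ?_⟩ ⟨w, hw, hY, rfl⟩
  rintro r ⟨w, hw, -, rfl⟩
  exact Finset.sum_nonneg fun i _ => hw i

theorem le_rhoStar {V ι : Type*} [Fintype ι] [DecidableEq V] (X : ι → Finset V) {Y : Set V}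
    (hcov : ∀ A ∈ Y, ∃ i, A ∈ X i) {r : ℝ}
    (h : ∀ w : ι → ℝ, (∀ i, 0 ≤ w i) →
      (∀ A ∈ Y, 1 ≤ ∑ i ∈ Finset.univ.filter (fun i => A ∈ X i), w i) → r ≤ ∑ i, w i) :
    r ≤ rhoStar X Y := by
  refine le_csInf ⟨_, fun _ => 1, fun _ => zero_le_one, fun A hA => ?_, rfl⟩ ?_
  · obtain ⟨i, hi⟩ := hcov A hA
    exact Finset.single_le_sum (f := fun _ : ι => (1 : ℝ)) (fun _ _ => zero_le_one)
      (Finset.mem_filter.2 ⟨Finset.mem_univ i, hi⟩)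
  · rintro _ ⟨w, hw, hY, rfl⟩
    exact h w hw hY

theorem rhoStar_le_one {V ι : Type*} [Fintype ι] [DecidableEq V] (X : ι → Finset V) {Y : Set V}
    (i : ι) (hY : Y ⊆ X i) : rhoStar X Y ≤ 1 := by
  have hw : ∀ j, 0 ≤ (Pi.single i 1 : ι → ℝ) j := fun j => by
    by_cases h : j = i
    · subst h; simp
    · simp [h]
  refine (rhoStar_le_sum X (Pi.single i 1) hw fun A hA => ?_).trans_eq (by simp)
  calc (1 : ℝ) = (Pi.single i 1 : ι → ℝ) i := by simp
    _ ≤ _ := Finset.single_le_sum (fun j _ => hw j)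
      (Finset.mem_filter.2 ⟨Finset.mem_univ i, hY hA⟩)

theorem rhoStar_eq_one {V ι : Type*} [Fintype ι] [DecidableEq V] (X : ι → Finset V) {Y : Set V}
    (i : ι) (hY : Y ⊆ X i) (hne : Y.Nonempty) : rhoStar X Y = 1 := by
  refine (rhoStar_le_one X i hY).antisymm (le_rhoStar X (fun A hA => ⟨i, hY hA⟩) ?_)
  intro w hw h
  obtain ⟨A, hA⟩ := hne
  exact (h A hA).trans
    (Finset.sum_le_sum_of_subset_of_nonneg (Finset.filter_subset _ _) fun j _ _ => hw j)

/-- Two variables that share no atom need disjoint sets of atoms to cover them. -/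
theorem two_le_rhoStar {V ι : Type*} [Fintype ι] [DecidableEq V] (X : ι → Finset V) {Y : Set V}
    (hcov : ∀ A ∈ Y, ∃ i, A ∈ X i) {x y : V} (hx : x ∈ Y) (hy : y ∈ Y)
    (hxy : ∀ i, x ∈ X i → y ∉ X i) : 2 ≤ rhoStar X Y := by
  refine le_rhoStar X hcov fun w hw h => ?_
  have hdisj : Disjoint (Finset.univ.filter (fun i => x ∈ X i))
      (Finset.univ.filter (fun i => y ∈ X i)) := by
    rw [Finset.disjoint_filter]
    exact fun i _ => hxy i
  have hle : ∑ i ∈ (Finset.univ.filter (fun i => x ∈ X i)).disjUnion _ hdisj, w i ≤ ∑ i, w i :=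
    Finset.sum_le_sum_of_subset_of_nonneg (Finset.subset_univ _) fun j _ _ => hw j
  rw [Finset.sum_disjUnion] at hle
  linarith [h x hx, h y hy]

theorem self_mem_ancc {V : Type*} (par : V → V) (x : V) : x ∈ ancc par x := ⟨0, rfl⟩

theorem mem_ancc_trans {V : Type*} {par : V → V} {x y z : V}
    (hxy : x ∈ ancc par y) (hyz : y ∈ ancc par z) : x ∈ ancc par z := by
  obtain ⟨m, rfl⟩ := hxy
  obtain ⟨n, rfl⟩ := hyz
  exact ⟨m + n, Function.iterate_add_apply par m n z⟩

/-- Two ancestors of a common node are comparable. -/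
theorem ancc_comparable {V : Type*} {par : V → V} {x y z : V}
    (hx : x ∈ ancc par z) (hy : y ∈ ancc par z) : x ∈ ancc par y ∨ y ∈ ancc par x := by
  obtain ⟨m, rfl⟩ := hx
  obtain ⟨n, rfl⟩ := hy
  rcases le_total m n with h | h
  · refine Or.inr ⟨n - m, ?_⟩
    rw [← Function.iterate_add_apply, Nat.sub_add_cancel h]
  · refine Or.inl ⟨m - n, ?_⟩
    rw [← Function.iterate_add_apply, Nat.sub_add_cancel h]

/-- If consecutive elements of `a, b, c, d` are comparable in a rooted tree, then some branch
contains two non-consecutive ones. -/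
theorem exists_branch_of_path {V : Type*} {par : V → V} {a b c d : V}
    (hab : a ∈ ancc par b ∨ b ∈ ancc par a) (hbc : b ∈ ancc par c ∨ c ∈ ancc par b)
    (hcd : c ∈ ancc par d ∨ d ∈ ancc par c) :
    ∃ z, (a ∈ ancc par z ∧ c ∈ ancc par z) ∨ (b ∈ ancc par z ∧ d ∈ ancc par z) := by
  rcases hbc with hbc | hbc
  · rcases hcd with hcd | hcd
    · exact ⟨d, Or.inr ⟨mem_ancc_trans hbc hcd, self_mem_ancc par d⟩⟩
    · exact ⟨c, Or.inr ⟨hbc, hcd⟩⟩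
  · rcases hab with hab | hab
    · exact ⟨b, Or.inl ⟨hab, hbc⟩⟩
    · exact ⟨a, Or.inl ⟨self_mem_ancc par a, mem_ancc_trans hbc hab⟩⟩

theorem rhoStar_ancc_le_tExp {V ι : Type*} [Fintype V] [Fintype ι] [DecidableEq V]
    (X : ι → Finset V) (par : V → V) (z : V) :
    rhoStar X (ancc par z) ≤ tExp X (∅ : Set V) par := by
  have h := le_ciSup (Set.finite_range fun A : V =>
    rhoStar X (ancc par A ∪ (descO par A ∩ (∅ : Set V)))).bddAbove z
  simpa only [tExp, Set.inter_empty, Set.union_empty] using h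

/-- In the rooted path `0 - 1 - 2` the ancestors of a node are the nodes below it in order. -/
theorem mem_ancc_path_iff (u v : Fin 3) :
    u ∈ ancc (fun v : Fin 3 => if v = 2 then 1 else 0) v ↔ u ≤ v := by
  constructor
  · rintro ⟨n, rfl⟩
    induction n with
    | zero => exact le_rfl
    | succ n ih =>
      rw [Function.iterate_succ_apply']
      refine le_trans ?_ ih
      generalize (fun v : Fin 3 => if v = 2 then (1 : Fin 3) else 0)^[n] v = x
      revert x
      decide
  · intro h
    refine ⟨(v - u : ℕ), ?_⟩
    revert u v
    decide

/-- For the scalar 4-path query (`V = {a,b,c,d}`, atoms `{a,b}`, `{b,c}`,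
`{c,d}`, output variables `∅`):
(i) the path-shaped tree with three nodes and bags `{a,b}`, `{b,c}`, `{c,d}` (rooted at
the node with bag `{a,b}`) is a tree decomposition with `TD(GJ)` space exponent `1` and
time exponent `1`; and (ii) every pseudo-tree `P` of the query has `t(P) ≥ 2`. -/
theorem stmt_9 {V : Type*} [Fintype V] [DecidableEq V]
    (a b c d : V) (hab : a ≠ b) (hac : a ≠ c) (had : a ≠ d)
    (hbc : b ≠ c) (hbd : b ≠ d) (hcd : c ≠ d)
    (hV : ∀ x : V, x = a ∨ x = b ∨ x = c ∨ x = d)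
    (X : Fin 3 → Finset V)
    (hX : X 0 = {a, b} ∧ X 1 = {b, c} ∧ X 2 = {c, d}) :
    (IsRootedTree (0 : Fin 3) (fun v : Fin 3 => if v = 2 then 1 else 0) ∧
      IsTreeDecomp X (∅ : Set V) (0 : Fin 3) (fun v : Fin 3 => if v = 2 then 1 else 0)
        (fun v : Fin 3 => if v = 0 then ({a, b} : Set V) else if v = 1 then {b, c} else {c, d}) ∧
      tdSpace X (∅ : Set V) (0 : Fin 3) (fun v : Fin 3 => if v = 2 then 1 else 0)
        (fun v : Fin 3 => if v = 0 then ({a, b} : Set V) else if v = 1 then {b, c} else {c, d}) = 1 ∧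
      tdTime X
        (fun v : Fin 3 => if v = 0 then ({a, b} : Set V) else if v = 1 then {b, c} else {c, d}) = 1) ∧
    (∀ (root : V) (par : V → V), IsRootedTree root par → IsPseudoTree X par →
      2 ≤ tExp X (∅ : Set V) par) := by
  obtain ⟨h0, h1, h2⟩ := hX
  refine ⟨⟨⟨by decide, fun v => (mem_ancc_path_iff 0 v).2 (Fin.zero_le v)⟩,
    ⟨Set.empty_subset _, ?_, ?_⟩, ?_, ?_⟩, ?_⟩
  · intro A v w hv hw
    refine ⟨min v w, ?_⟩
    simp only [mem_ancc_path_iff]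
    refine ⟨by rcases min_choice v w with h | h <;> rwa [h], min_le_left _ _, min_le_right _ _, ?_⟩
    rcases hV A with rfl | rfl | rfl | rfl <;> fin_cases v <;> fin_cases w <;>
      simp_all [Fin.forall_fin_succ] <;> grind
  · intro i
    refine ⟨i, ?_⟩
    fin_cases i <;> simp [h0, h1, h2]
  · have hedge : ∀ v : {v : Fin 3 // v ≠ 0}, rhoStar X
        ((fun v : Fin 3 => if v = 0 then ({a, b} : Set V) else if v = 1 then {b, c} else {c, d})
          ((fun v : Fin 3 => if v = 2 then 1 else 0) v.1) ∩
        (fun v : Fin 3 => if v = 0 then ({a, b} : Set V) else if v = 1 then {b, c} else {c, d})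
          v.1) = 1 := by
      rintro ⟨v, hv⟩
      refine rhoStar_eq_one X v (Set.inter_subset_right.trans ?_) ?_
      · fin_cases v <;> simp [h0, h1, h2]
      · fin_cases v
        · exact absurd rfl hv
        · exact ⟨b, by simp⟩
        · exact ⟨c, by simp⟩
    have : Nonempty {v : Fin 3 // v ≠ 0} := ⟨⟨1, by decide⟩⟩
    rw [tdSpace, iSup_congr hedge, ciSup_const]
    exact max_eq_right (rhoStar_le_one X 0 (Set.empty_subset _))
  · have hbag : ∀ v : Fin 3, rhoStar X
        ((fun v : Fin 3 => if v = 0 then ({a, b} : Set V) else if v = 1 then {b, c} else {c, d})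
          v) = 1 := by
      intro v
      refine rhoStar_eq_one X v ?_ ?_ <;> fin_cases v <;> simp [h0, h1, h2]
    rw [tdTime, iSup_congr hbag, ciSup_const]
  · intro root par _ hP
    have hcomp : ∀ i, ∀ x ∈ X i, ∀ y ∈ X i, x ∈ ancc par y ∨ y ∈ ancc par x := by
      intro i x hx y hy
      obtain ⟨z, hz⟩ := hP i
      exact ancc_comparable (hz hx) (hz hy)
    have hcov : ∀ x : V, ∃ i, x ∈ X i := by
      intro x
      rcases hV x with rfl | rfl | rfl | rfl
      · exact ⟨0, by simp [h0]⟩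
      · exact ⟨0, by simp [h0]⟩
      · exact ⟨1, by simp [h1]⟩
      · exact ⟨2, by simp [h2]⟩
    obtain ⟨z, ⟨hx, hy⟩ | ⟨hx, hy⟩⟩ := exists_branch_of_path
      (hcomp 0 a (by simp [h0]) b (by simp [h0])) (hcomp 1 b (by simp [h1]) c (by simp [h1]))
      (hcomp 2 c (by simp [h2]) d (by simp [h2]))
    · refine (two_le_rhoStar X (fun A _ => hcov A) hx hy ?_).trans (rhoStar_ancc_le_tExp X par z)
      intro i
      fin_cases i <;> simp [h0, h1, h2, hab, hac, had, hac.symm, hbc.symm]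
    · refine (two_le_rhoStar X (fun A _ => hcov A) hx hy ?_).trans (rhoStar_ancc_le_tExp X par z)
      intro i
      fin_cases i <;> simp [h0, h1, h2, hbc, hbd, had.symm, hbd.symm, hcd.symm]
end

section
/- Let (P, C) be a pseudo-tree with caching and resets (PTCR) of a query hypergraph Q. Then the pair (P, χ) with χ(A) = ra(A) ∪ out⁺(A) for every A ∈ V is a tree decomposition of Q. Consequently, fhw(Q) ≤ t(P, C) for every PTCR (P, C) of Q. -/
open scoped Classical

section RootedTree

variable {V : Type*} {par : V → V} {root A B C : V}

lemma ancc_refl (par : V → V) (A : V) : A ∈ ancc par A := ⟨0, rfl⟩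

lemma par_mem_ancc (par : V → V) (A : V) : par A ∈ ancc par A := ⟨1, rfl⟩

lemma ancc_trans (hBA : B ∈ ancc par A) (hCB : C ∈ ancc par B) : C ∈ ancc par A := by
  obtain ⟨n, rfl⟩ := hBA
  obtain ⟨m, rfl⟩ := hCB
  exact ⟨m + n, Function.iterate_add_apply par m n A⟩

lemma mem_ancc_par (h : B ∈ ancc par A) (hne : B ≠ A) : B ∈ ancc par (par A) := by
  obtain ⟨_ | n, rfl⟩ := h
  · exact absurd rfl hne
  · exact ⟨n, rfl⟩

lemma ancc_total (hB : B ∈ ancc par A) (hC : C ∈ ancc par A) :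
    B ∈ ancc par C ∨ C ∈ ancc par B := by
  obtain ⟨n, rfl⟩ := hB
  obtain ⟨m, rfl⟩ := hC
  rcases le_total n m with h | h
  · obtain ⟨k, rfl⟩ := Nat.exists_eq_add_of_le' h
    exact Or.inr ⟨k, (Function.iterate_add_apply par k n A).symm⟩
  · obtain ⟨k, rfl⟩ := Nat.exists_eq_add_of_le' h
    exact Or.inl ⟨k, (Function.iterate_add_apply par k m A).symm⟩

/-- A nonempty set lying on one branch has a deepest element. -/
lemma exists_deepest {S : Set V} (hS : S.Nonempty) (h : S ⊆ ancc par A) :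
    ∃ B ∈ S, S ⊆ ancc par B := by
  classical
  have hex : ∃ n, par^[n] A ∈ S := by
    obtain ⟨B, hB⟩ := hS
    obtain ⟨n, rfl⟩ := h hB
    exact ⟨n, hB⟩
  refine ⟨_, Nat.find_spec hex, fun B hB => ?_⟩
  obtain ⟨m, rfl⟩ := h hB
  obtain ⟨k, hk⟩ := Nat.exists_eq_add_of_le' (Nat.find_min' hex hB)
  exact ⟨k, by rw [← Function.iterate_add_apply, ← hk]⟩

lemma IsRootedTree.root_mem_ancc (hT : IsRootedTree root par) (A : V) : root ∈ ancc par A :=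
  hT.2 A

lemma IsRootedTree.eq_root_of_mem_ancc_root (hT : IsRootedTree root par)
    (h : A ∈ ancc par root) : A = root := by
  obtain ⟨n, rfl⟩ := h
  exact Function.iterate_fixed hT.1 n

lemma IsRootedTree.par_eq_self_of_mem_ancc_par (hT : IsRootedTree root par)
    (h : A ∈ ancc par (par A)) : par A = A := by
  obtain ⟨n, hn⟩ := h
  obtain ⟨m, hm⟩ := hT.2 A
  have hper : par^[(n + 1) * m] A = A := by
    rw [Function.iterate_mul]
    exact Function.iterate_fixed hn m
  have hle : m ≤ (n + 1) * m := Nat.le_mul_of_pos_left m n.succ_pos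
  obtain ⟨k, hk⟩ := Nat.exists_eq_add_of_le' hle
  rw [hk, Function.iterate_add_apply, hm, Function.iterate_fixed hT.1] at hper
  rw [← hper, hT.1]

lemma IsRootedTree.induction (hT : IsRootedTree root par) {p : V → Prop}
    (hroot : p root) (hstep : ∀ A, p (par A) → p A) (A : V) : p A := by
  obtain ⟨n, hn⟩ := hT.2 A
  induction n generalizing A with
  | zero => exact (show A = root from hn) ▸ hroot
  | succ n ih => exact hstep A (ih (par A) hn)

end RootedTree

section Context

variable {V ι : Type*} {X : ι → Finset V} {root : V} {par : V → V} {Csize : V → ℕ}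
  {ria ra : V → Set V}

lemma conSet_subset_ancc (X : ι → Finset V) (par : V → V) (A : V) :
    conSet X par A ⊆ ancc par A := fun _ hB => hB.1.1

lemma conSet_root (hT : IsRootedTree root par) : conSet X par root = ∅ :=
  Set.eq_empty_of_forall_notMem fun _ hB => hB.1.2 (hT.eq_root_of_mem_ancc_root hB.1.1)

lemma conSet_subset_insert_conSet_par (X : ι → Finset V) (par : V → V) (A : V) :
    conSet X par A ⊆ insert (par A) (conSet X par (par A)) := by
  rintro B ⟨⟨hB, hne⟩, C, hC, i, hi⟩
  by_cases hBp : B = par A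
  · exact Or.inl hBp
  · exact Or.inr ⟨⟨mem_ancc_par hB hne, hBp⟩, C, ancc_trans hC (par_mem_ancc par A), i, hi⟩

lemma exists_deepest_iconSet {A : V} (h : (iconSet X root par Csize A).Nonempty) :
    ∃ B ∈ iconSet X root par Csize A, iconSet X root par Csize A ⊆ ancc par B :=
  exists_deepest h (Set.sdiff_subset.trans (conSet_subset_ancc X par A))

lemma exists_atom_subset_insert_conSet (hPT : IsPseudoTree X par) (root : V) (i : ι) :
    ∃ v, (X i : Set V) ⊆ insert v (conSet X par v) := by
  rcases (X i : Set V).eq_empty_or_nonempty with h | h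
  · exact ⟨root, h ▸ Set.empty_subset _⟩
  · obtain ⟨A, hA⟩ := hPT i
    obtain ⟨v, hv, hsub⟩ := exists_deepest h hA
    refine ⟨v, fun B hB => ?_⟩
    by_cases hBv : B = v
    · exact Or.inl hBv
    · exact Or.inr ⟨⟨hsub hB, hBv⟩, v, ancc_refl par v, i, hB, hv⟩

/-- The defining top-down recurrence of the relevant-ancestor functions of a PTCR. -/
structure IsRelevantAncestors (X : ι → Finset V) (root : V) (par : V → V) (Csize : V → ℕ)
    (ria ra : V → Set V) : Prop where
  ria_eq_empty : ∀ A, iconSet X root par Csize A = ∅ → ria A = ∅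
  ria_eq_inter : ∀ A B, B ∈ iconSet X root par Csize A →
    iconSet X root par Csize A ⊆ ancc par B → ria A = ra (par A) ∩ ancc par B
  ra_eq : ∀ A, ra A = ria A ∪ sconSet X root par Csize A ∪ {A}

namespace IsRelevantAncestors

variable (h : IsRelevantAncestors X root par Csize ria ra)
include h

lemma self_mem_ra (A : V) : A ∈ ra A := by
  rw [h.ra_eq]
  exact Or.inr rfl

lemma ria_subset_ancc (A : V) : ria A ⊆ ancc par A := by
  rcases (iconSet X root par Csize A).eq_empty_or_nonempty with h0 | h0
  · simp [h.ria_eq_empty A h0]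
  · obtain ⟨B, hB, hsub⟩ := exists_deepest_iconSet h0
    rw [h.ria_eq_inter A B hB hsub]
    exact fun D hD => ancc_trans (conSet_subset_ancc X par A hB.1) hD.2

lemma ria_subset_ra_par (A : V) : ria A ⊆ ra (par A) := by
  rcases (iconSet X root par Csize A).eq_empty_or_nonempty with h0 | h0
  · simp [h.ria_eq_empty A h0]
  · obtain ⟨B, hB, hsub⟩ := exists_deepest_iconSet h0
    rw [h.ria_eq_inter A B hB hsub]
    exact Set.inter_subset_left

lemma ra_subset_ancc (A : V) : ra A ⊆ ancc par A := by
  rw [h.ra_eq]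
  rintro B ((hB | hB) | rfl)
  · exact h.ria_subset_ancc A hB
  · exact conSet_subset_ancc X par A hB.1
  · exact ancc_refl par B

lemma conSet_subset_ra (hT : IsRootedTree root par) (A : V) : conSet X par A ⊆ ra A := by
  refine hT.induction (p := fun A => conSet X par A ⊆ ra A) ?_ (fun A ih => ?_) A
  · simp [conSet_root hT]
  · intro D hD
    rw [h.ra_eq]
    by_cases hs : D ∈ sconSet X root par Csize A
    · exact Or.inl (Or.inr hs)
    · have hDi : D ∈ iconSet X root par Csize A := ⟨hD, hs⟩
      obtain ⟨B, hB, hsub⟩ := exists_deepest_iconSet ⟨D, hDi⟩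
      refine Or.inl (Or.inl ?_)
      rw [h.ria_eq_inter A B hB hsub]
      refine ⟨?_, hsub hDi⟩
      rcases conSet_subset_insert_conSet_par X par A hD with rfl | hD'
      · exact h.self_mem_ra (par A)
      · exact ih hD'

lemma mem_ra_par (hT : IsRootedTree root par) {A B : V} (hB : B ∈ ra A) (hne : B ≠ A) :
    B ∈ ra (par A) := by
  rw [h.ra_eq] at hB
  rcases hB with (hB | hB) | hB
  · exact h.ria_subset_ra_par A hB
  · rcases conSet_subset_insert_conSet_par X par A hB.1 with rfl | hB'
    · exact h.self_mem_ra (par A)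
    · exact h.conSet_subset_ra hT (par A) hB'
  · exact absurd hB hne

/-- The nodes whose relevant ancestors include `A` are closed under moving up towards `A`. -/
lemma mem_ra_of_mem_ancc (hT : IsRootedTree root par) {A u v : V} (hA : A ∈ ra v)
    (hu : u ∈ ancc par v) (hAu : A ∈ ancc par u) : A ∈ ra u := by
  obtain ⟨n, rfl⟩ := hu
  induction n with
  | zero => exact hA
  | succ n ih =>
    rw [Function.iterate_succ_apply'] at hAu ⊢
    have hw := ih (ancc_trans (par_mem_ancc par _) hAu)
    by_cases hne : A = par^[n] v
    · rw [← hne] at hAu ⊢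
      rw [hT.par_eq_self_of_mem_ancc_par hAu]
      exact h.self_mem_ra A
    · exact h.mem_ra_par hT hw hne

lemma mem_bag_of_mem_output (hT : IsRootedTree root par) {Xout : Set V} {A u v : V}
    (hA : A ∈ Xout) (hv : A ∈ ra v ∪ (descc par v ∩ Xout)) (hu : u ∈ ancc par v) :
    A ∈ ra u ∪ (descc par u ∩ Xout) := by
  rcases hv with hv | hv
  · rcases ancc_total (h.ra_subset_ancc v hv) hu with hAu | huA
    · exact Or.inl (h.mem_ra_of_mem_ancc hT hv hu hAu)
    · exact Or.inr ⟨huA, hA⟩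
  · exact Or.inr ⟨ancc_trans hv.1 hu, hA⟩

theorem isTreeDecomp (hT : IsRootedTree root par) (hPT : IsPseudoTree X par) (Xout : Set V) :
    IsTreeDecomp X Xout root par (fun A => ra A ∪ (descc par A ∩ Xout)) := by
  refine ⟨fun A hA => Or.inr ⟨hT.root_mem_ancc A, hA⟩, fun A v w hv hw => ?_, fun i => ?_⟩
  · by_cases hA : A ∈ Xout
    · exact ⟨root, Or.inr ⟨hT.root_mem_ancc A, hA⟩, hT.root_mem_ancc v, hT.root_mem_ancc w,
        fun u hu _ => h.mem_bag_of_mem_output hT hA hv hu,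
        fun u hu _ => h.mem_bag_of_mem_output hT hA hw hu⟩
    · have hv' : A ∈ ra v := hv.resolve_right fun h' => hA h'.2
      have hw' : A ∈ ra w := hw.resolve_right fun h' => hA h'.2
      exact ⟨A, Or.inl (h.self_mem_ra A), h.ra_subset_ancc v hv', h.ra_subset_ancc w hw',
        fun u hu hAu => Or.inl (h.mem_ra_of_mem_ancc hT hv' hu hAu),
        fun u hu hAu => Or.inl (h.mem_ra_of_mem_ancc hT hw' hu hAu)⟩
  · obtain ⟨v, hv⟩ := exists_atom_subset_insert_conSet hPT root i
    refine ⟨v, hv.trans (Set.insert_subset (Or.inl (h.self_mem_ra v)) ?_)⟩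
    exact (h.conSet_subset_ra hT v).trans Set.subset_union_left

lemma bag_eq (Xout : Set V) (A : V) :
    ra A ∪ (descc par A ∩ Xout) = ra A ∪ (descO par A ∩ Xout) := by
  refine Set.Subset.antisymm ?_ (Set.union_subset_union_right _ fun B hB => ⟨hB.1.1, hB.2⟩)
  rintro B (hB | hB)
  · exact Or.inl hB
  · by_cases hBA : A = B
    · exact Or.inl (hBA ▸ h.self_mem_ra A)
    · exact Or.inr ⟨⟨hB.1, hBA⟩, hB.2⟩

end IsRelevantAncestors

end Context

section Width

variable {V ν μ ι : Type*}

lemma rhoStar_nonneg [Fintype ι] [DecidableEq V] (X : ι → Finset V) (Y : Set V) :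
    0 ≤ rhoStar X Y := by
  refine Real.sInf_nonneg ?_
  rintro r ⟨w, hw, -, rfl⟩
  exact Finset.sum_nonneg fun i _ => hw i

lemma iterate_equiv_conj (e : ν ≃ μ) (par : ν → ν) (n : ℕ) (a : μ) :
    (fun x => e (par (e.symm x)))^[n] a = e (par^[n] (e.symm a)) := by
  induction n with
  | zero => simp
  | succ n ih => simp only [Function.iterate_succ_apply', ih, Equiv.symm_apply_apply]

lemma mem_ancc_equiv_conj (e : ν ≃ μ) (par : ν → ν) (a b : μ) :
    a ∈ ancc (fun x => e (par (e.symm x))) b ↔ e.symm a ∈ ancc par (e.symm b) := by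
  simp only [ancc, Set.mem_ofPred_eq, iterate_equiv_conj, Equiv.eq_symm_apply]

lemma IsRootedTree.equiv_conj (e : ν ≃ μ) {root : ν} {par : ν → ν}
    (hT : IsRootedTree root par) : IsRootedTree (e root) (fun x => e (par (e.symm x))) := by
  refine ⟨by simp [hT.1], fun A => ?_⟩
  obtain ⟨n, hn⟩ := hT.2 (e.symm A)
  exact ⟨n, by rw [iterate_equiv_conj, hn]⟩

lemma IsTreeDecomp.equiv_conj (e : ν ≃ μ) {X : ι → Finset V} {Xout : Set V} {root : ν}
    {par : ν → ν} {χ : ν → Set V} (h : IsTreeDecomp X Xout root par χ) :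
    IsTreeDecomp X Xout (e root) (fun x => e (par (e.symm x))) (fun x => χ (e.symm x)) := by
  obtain ⟨hout, hconn, hatom⟩ := h
  refine ⟨by simpa using hout, fun A v w hv hw => ?_, fun i => ?_⟩
  · obtain ⟨t, ht, htv, htw, h₁, h₂⟩ := hconn A _ _ hv hw
    simp only [mem_ancc_equiv_conj]
    refine ⟨e t, ?_⟩
    simp only [Equiv.symm_apply_apply]
    exact ⟨ht, htv, htw, fun u => h₁ _, fun u => h₂ _⟩
  · obtain ⟨v, hv⟩ := hatom i
    exact ⟨e v, by simpa using hv⟩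

lemma fhw_le_tdTime [Fintype V] [Fintype ν] [Fintype ι] [DecidableEq V] {X : ι → Finset V}
    {Xout : Set V} {root : ν} {par : ν → ν} {χ : ν → Set V} (hT : IsRootedTree root par)
    (h : IsTreeDecomp X Xout root par χ) : fhw X Xout ≤ tdTime X χ := by
  refine csInf_le ⟨0, ?_⟩ ?_
  · rintro r ⟨n, root, par, χ, -, -, rfl⟩
    exact Real.iSup_nonneg fun v => rhoStar_nonneg X _
  · let e := Fintype.equivFin ν
    exact ⟨_, _, _, _, hT.equiv_conj e, h.equiv_conj e,
      (e.symm.iSup_comp (g := fun v => rhoStar X (χ v))).symm⟩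

end Width

/-- For every PTCR `(P, C)` of a query hypergraph `Q` (with relevant
ancestor functions `ria`, `ra` satisfying their defining top-down recurrence), the pair
`(P, χ)` with `χ(A) = ra(A) ∪ out⁺(A)` is a tree decomposition of `Q`; consequently
`fhw(Q) ≤ t(P, C)`. -/
theorem stmt_13 {V ι : Type*} [Fintype V] [DecidableEq V] [Fintype ι]
    (X : ι → Finset V) (hvar : ∀ A : V, ∃ i, A ∈ X i) (Xout : Set V)
    (root : V) (par : V → V)
    (hT : IsRootedTree root par) (hPT : IsPseudoTree X par)
    (Csize : V → ℕ) (ria ra : V → Set V)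
    (hria0 : ∀ A, iconSet X root par Csize A = ∅ → ria A = ∅)
    (hriaS : ∀ A B, B ∈ iconSet X root par Csize A →
      iconSet X root par Csize A ⊆ ancc par B → ria A = ra (par A) ∩ ancc par B)
    (hra : ∀ A, ra A = ria A ∪ sconSet X root par Csize A ∪ {A}) :
    IsTreeDecomp X Xout root par (fun A => ra A ∪ (descc par A ∩ Xout)) ∧
    fhw X Xout ≤ tPTCR X Xout par ra := by
  have h : IsRelevantAncestors X root par Csize ria ra := ⟨hria0, hriaS, hra⟩
  have hTD := h.isTreeDecomp hT hPT Xout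
  refine ⟨hTD, (fhw_le_tdTime hT hTD).trans_eq ?_⟩
  simp only [tdTime, tPTCR, h.bag_eq]
end

section
/- Let (P, C) be a pseudo-tree with caching and resets (PTCR) of a query hypergraph Q. Then for every variable A ∈ V: (1) con(A) ⊆ raexc(A) ⊆ anc(A); (2) con(A) ∪ {A} ⊆ ra(A) ⊆ anc⁺(A); (3) if icon(A) ≠ ∅ then icon(A) ⊆ ria(A) ⊆ anc⁺(min(icon(A))); and (4) if A is not the root of P then raexc(A) ⊆ ra(parent(A)). -/
open scoped Classical

theorem mem_ancc_self {V : Type*} (par : V → V) (A : V) : A ∈ ancc par A := ⟨0, rfl⟩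

theorem ancc_parent_subset {V : Type*} (par : V → V) (A : V) :
    ancc par (par A) ⊆ ancc par A := by
  rintro B ⟨n, hn⟩
  exact ⟨n + 1, by rwa [Function.iterate_succ_apply]⟩

theorem mem_ancc_parent_of_mem_anc {V : Type*} {par : V → V} {A B : V}
    (h : B ∈ anc par A) : B ∈ ancc par (par A) := by
  obtain ⟨⟨n, hn⟩, hne⟩ := h
  cases n with
  | zero => exact absurd hn.symm hne
  | succ n => exact ⟨n, by rwa [Function.iterate_succ_apply] at hn⟩

theorem descc_subset_descc_parent {V : Type*} (par : V → V) (A : V) :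
    descc par A ⊆ descc par (par A) := by
  rintro C ⟨n, hn⟩
  exact ⟨n + 1, by rw [Function.iterate_succ_apply', hn]⟩

theorem anc_root_eq_empty {V : Type*} {root : V} {par : V → V} (hr : par root = root) :
    anc par root = ∅ := by
  refine Set.eq_empty_iff_forall_notMem.2 ?_
  rintro B ⟨⟨n, hn⟩, hne⟩
  rw [Function.iterate_fixed hr] at hn
  exact hne hn.symm

theorem IsRootedTree.notMem_ancc_parent {V : Type*} {root : V} {par : V → V}
    (hT : IsRootedTree root par) {A : V} (hA : A ≠ root) : A ∉ ancc par (par A) := by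
  rintro ⟨n, hn⟩
  obtain ⟨m, hm⟩ := hT.2 A
  rw [← Function.iterate_succ_apply] at hn
  have h1 : par^[(n + 1) * m] A = A := by
    rw [Function.iterate_mul, Function.iterate_fixed hn]
  have h2 : par^[n * m + m] A = root := by
    rw [Function.iterate_add_apply, hm, Function.iterate_fixed hT.1]
  rw [Nat.succ_mul] at h1
  exact hA (h1.symm.trans h2)

theorem IsRootedTree.ancc_parent_subset_anc {V : Type*} {root : V} {par : V → V}
    (hT : IsRootedTree root par) {A : V} (hA : A ≠ root) :
    ancc par (par A) ⊆ anc par A := by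
  refine fun B hB => ⟨ancc_parent_subset par A hB, ?_⟩
  rintro rfl
  exact hT.notMem_ancc_parent hA hB

/-- A nonempty set lying on one branch has a deepest element. -/
theorem exists_mem_subset_ancc {V : Type*} {par : V → V} {A : V} {S : Set V}
    (hS : S ⊆ ancc par A) (hne : S.Nonempty) : ∃ B ∈ S, S ⊆ ancc par B := by
  have hex : ∃ n, par^[n] A ∈ S := by
    obtain ⟨B, hB⟩ := hne
    obtain ⟨n, rfl⟩ := hS hB
    exact ⟨n, hB⟩
  refine ⟨_, Nat.find_spec hex, fun B hB => ?_⟩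
  obtain ⟨n, rfl⟩ := hS hB
  refine ⟨n - Nat.find hex, ?_⟩
  rw [← Function.iterate_add_apply, Nat.sub_add_cancel (Nat.find_min' hex hB)]

theorem conSet_subset_insert_parent {V ι : Type*} (X : ι → Finset V) (par : V → V) (A : V) :
    conSet X par A ⊆ conSet X par (par A) ∪ {par A} := by
  rintro B ⟨hB, C, hC, hi⟩
  by_cases h : B = par A
  · exact Or.inr h
  · exact Or.inl ⟨⟨mem_ancc_parent_of_mem_anc hB, h⟩, C, descc_subset_descc_parent par A hC, hi⟩

/-- Basic inclusions for the relevant-ancestor sets of a PTCR `(P, C)`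
(with `ria`, `ra` satisfying their defining top-down recurrence, and
`raexc(A) = ria(A) ∪ scon(A)`): for every variable `A`,
(1) `con(A) ⊆ raexc(A) ⊆ anc(A)`;
(2) `con(A) ∪ {A} ⊆ ra(A) ⊆ anc⁺(A)`;
(3) if `icon(A) ≠ ∅` then `icon(A) ⊆ ria(A) ⊆ anc⁺(min(icon(A)))`
    (where `min(icon(A))` is the unique `B ∈ icon(A)` with `icon(A) ⊆ anc⁺(B)`);
(4) if `A` is not the root then `raexc(A) ⊆ ra(parent(A))`. -/
theorem stmt_14 {V ι : Type*} [Fintype V] [DecidableEq V] [Fintype ι]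
    (X : ι → Finset V) (hvar : ∀ A : V, ∃ i, A ∈ X i)
    (root : V) (par : V → V)
    (hT : IsRootedTree root par) (hPT : IsPseudoTree X par)
    (Csize : V → ℕ) (ria ra : V → Set V)
    (hria0 : ∀ A, iconSet X root par Csize A = ∅ → ria A = ∅)
    (hriaS : ∀ A B, B ∈ iconSet X root par Csize A →
      iconSet X root par Csize A ⊆ ancc par B → ria A = ra (par A) ∩ ancc par B)
    (hra : ∀ A, ra A = ria A ∪ sconSet X root par Csize A ∪ {A}) :
    ∀ A : V,
      (conSet X par A ⊆ ria A ∪ sconSet X root par Csize A ∧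
        ria A ∪ sconSet X root par Csize A ⊆ anc par A) ∧
      (conSet X par A ∪ {A} ⊆ ra A ∧ ra A ⊆ ancc par A) ∧
      (∀ B, B ∈ iconSet X root par Csize A → iconSet X root par Csize A ⊆ ancc par B →
        iconSet X root par Csize A ⊆ ria A ∧ ria A ⊆ ancc par B) ∧
      (A ≠ root → ria A ∪ sconSet X root par Csize A ⊆ ra (par A)) := by
  have hsub : ∀ A, sconSet X root par Csize A ⊆ conSet X par A := fun A B hB => hB.1
  have hisub : ∀ A, iconSet X root par Csize A ⊆ conSet X par A := fun A B hB => hB.1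
  have hanc : ∀ A, conSet X par A ⊆ anc par A := fun A B hB => hB.1
  intro A
  obtain ⟨n, hn⟩ := hT.2 A
  induction n generalizing A with
  | zero =>
    obtain rfl : A = root := hn
    have hcon : conSet X par A = ∅ :=
      Set.subset_empty_iff.1 ((hanc A).trans (anc_root_eq_empty hT.1).subset)
    have hscon : sconSet X A par Csize A = ∅ := Set.subset_empty_iff.1 (hcon ▸ hsub A)
    have hicon : iconSet X A par Csize A = ∅ := Set.subset_empty_iff.1 (hcon ▸ hisub A)
    simp [hra, hria0 A hicon, hcon, hscon, hicon, mem_ancc_self]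
  | succ n ih =>
    by_cases hA : A = root
    · subst hA
      exact ih A (Function.iterate_fixed hT.1 n)
    obtain ⟨-, ⟨hlo, hhi⟩, -, -⟩ := ih (par A) hn
    have hconra : conSet X par A ⊆ ra (par A) :=
      (conSet_subset_insert_parent X par A).trans hlo
    have hmin : ∀ B, B ∈ iconSet X root par Csize A →
        iconSet X root par Csize A ⊆ ancc par B →
        iconSet X root par Csize A ⊆ ria A ∧ ria A ⊆ ancc par B := by
      intro B hB hBs
      rw [hriaS A B hB hBs]
      exact ⟨Set.subset_inter ((hisub A).trans hconra) hBs, Set.inter_subset_right⟩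
    have hria : iconSet X root par Csize A ⊆ ria A ∧ ria A ⊆ ra (par A) := by
      rcases (iconSet X root par Csize A).eq_empty_or_nonempty with h | h
      · simp [h, hria0 A h]
      · obtain ⟨B, hB, hBs⟩ := exists_mem_subset_ancc
          (fun B hB => (hanc A (hisub A hB)).1) h
        exact ⟨(hmin B hB hBs).1, (hriaS A B hB hBs).trans_subset Set.inter_subset_left⟩
    have hcon : conSet X par A ⊆ ria A ∪ sconSet X root par Csize A := by
      intro B hB
      by_cases h : B ∈ sconSet X root par Csize A
      · exact Or.inr h
      · exact Or.inl (hria.1 ⟨hB, h⟩)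
    have hexc : ria A ∪ sconSet X root par Csize A ⊆ ra (par A) :=
      Set.union_subset hria.2 ((hsub A).trans hconra)
    have hexcanc : ria A ∪ sconSet X root par Csize A ⊆ anc par A :=
      hexc.trans (hhi.trans (hT.ancc_parent_subset_anc hA))
    refine ⟨⟨hcon, hexcanc⟩, ?_, hmin, fun _ => hexc⟩
    rw [hra A]
    exact ⟨Set.union_subset_union_left _ hcon, Set.union_subset
      (hexcanc.trans Set.sdiff_subset) (Set.singleton_subset_iff.2 (mem_ancc_self par A))⟩
end

section
/- Let Q_hex be the scalar query hypergraph with variables V = {A, B, C, D, E, F}, output variables X = ∅, and atoms {A,B}, {A,C}, {A,D}, {A,E}, {A,F}, {B,C}, {B,D}, {B,E}, {B,F}, {C,D}, {D,E}, {E,F}. Then there exists a PTCR (P, C) of Q_hex with s(P, C) ≤ 1 and t(P, C) ≤ 2; indeed, the path pseudo-tree A → B → C → D → E → F together with the cache-size function C with C(E) = C(F) = 1 and C = 0 on all other variables achieves s(P, C) = 1 and t(P, C) = 2. -/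
open scoped Classical

theorem rhoStar_le_card {V ι : Type*} [Fintype ι] [DecidableEq V] (X : ι → Finset V)
    (Y : Set V) (T : Finset ι) (hT : ∀ A ∈ Y, ∃ i ∈ T, A ∈ X i) :
    rhoStar X Y ≤ T.card := by
  refine csInf_le ⟨0, ?_⟩ ⟨fun i => if i ∈ T then 1 else 0, ?_, ?_, ?_⟩
  · rintro r ⟨w, hw, -, rfl⟩
    exact Finset.sum_nonneg fun i _ => hw i
  · intro i
    dsimp only
    split_ifs <;> norm_num
  · intro A hA
    obtain ⟨i, hi, hAi⟩ := hT A hA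
    refine le_trans (le_of_eq (if_pos hi).symm)
      (Finset.single_le_sum (f := fun i => if i ∈ T then (1 : ℝ) else 0) ?_ (by simpa using hAi))
    intro j _
    split_ifs <;> norm_num
  · simp

theorem card_le_mul_rhoStar {V ι : Type*} [Fintype ι] [DecidableEq V] (X : ι → Finset V)
    (Y : Set V) (hY : ∀ A ∈ Y, ∃ i, A ∈ X i) (S : Finset V) (hS : ∀ A ∈ S, A ∈ Y)
    (k : ℕ) (hk : 0 < k) (hX : ∀ i, (S ∩ X i).card ≤ k) :
    (S.card : ℝ) ≤ k * rhoStar X Y := by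
  have hk' : (0 : ℝ) < k := by exact_mod_cast hk
  rw [← div_le_iff₀' hk']
  refine le_csInf ⟨_, fun _ => 1, fun _ => zero_le_one, ?_, rfl⟩ ?_
  · intro A hA
    obtain ⟨i, hi⟩ := hY A hA
    exact Finset.single_le_sum (f := fun _ => (1 : ℝ)) (fun _ _ => zero_le_one)
      (by simpa using hi)
  · rintro r ⟨w, hw, hcov, rfl⟩
    rw [div_le_iff₀' hk']
    calc (S.card : ℝ) = ∑ A ∈ S, (1 : ℝ) := by simp
      _ ≤ ∑ A ∈ S, ∑ i ∈ Finset.univ.filter (fun i => A ∈ X i), w i :=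
        Finset.sum_le_sum fun A hA => hcov A (hS A hA)
      _ = ∑ i, ((S ∩ X i).card : ℝ) * w i := by
        simp_rw [Finset.sum_filter]
        rw [Finset.sum_comm]
        refine Finset.sum_congr rfl fun i _ => ?_
        rw [← Finset.sum_filter, Finset.filter_mem_eq_inter, Finset.sum_const, nsmul_eq_mul]
      _ ≤ ∑ i, (k : ℝ) * w i :=
        Finset.sum_le_sum fun i _ =>
          mul_le_mul_of_nonneg_right (by exact_mod_cast hX i) (hw i)
      _ = k * ∑ i, w i := (Finset.mul_sum _ _ _).symm

theorem ancc_eq_insert {V : Type*} (par : V → V) (A : V) :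
    ancc par A = insert A (ancc par (par A)) := by
  ext B
  constructor
  · rintro ⟨_ | n, h⟩
    · exact Or.inl h.symm
    · exact Or.inr ⟨n, h⟩
  · rintro (rfl | ⟨n, h⟩)
    · exact ⟨0, rfl⟩
    · exact ⟨n + 1, h⟩

theorem ancc_of_fixed {V : Type*} {par : V → V} {A : V} (h : par A = A) :
    ancc par A = {A} := by
  ext B
  constructor
  · rintro ⟨n, rfl⟩
    exact Function.iterate_fixed h n
  · rintro rfl
    exact ⟨0, rfl⟩

theorem tdepth_root {V : Type*} (root : V) (par : V → V) : tdepth root par root = 0 :=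
  Nat.sInf_eq_zero.2 (Or.inl rfl)

theorem tdepth_eq_succ {V : Type*} {root : V} {par : V → V} (hT : IsRootedTree root par)
    {A : V} (hA : A ≠ root) : tdepth root par A = tdepth root par (par A) + 1 := by
  have hne : ∀ B, {n : ℕ | par^[n] B = root}.Nonempty := hT.2
  apply le_antisymm
  · exact Nat.sInf_le (Nat.sInf_mem (hne (par A)))
  · have h := Nat.sInf_mem (hne A)
    change par^[tdepth root par A] A = root at h
    rcases hn : tdepth root par A with _ | n
    · rw [hn] at h
      exact absurd h hA
    · rw [hn] at h
      exact Nat.succ_le_succ (Nat.sInf_le h)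

theorem sconSet_of_size_zero {V ι : Type*} (X : ι → Finset V) (root : V) (par : V → V)
    {Csize : V → ℕ} {A : V} (h : Csize A = 0) : sconSet X root par Csize A = ∅ := by
  ext B
  simp [sconSet, h]

theorem sconSet_of_size_one {V ι : Type*} [Finite V] (X : ι → Finset V) (root : V)
    (par : V → V) {Csize : V → ℕ} {A B : V} (h : Csize A = 1) (hB : B ∈ conSet X par A)
    (hlt : ∀ B' ∈ conSet X par A, B' ≠ B → tdepth root par B' < tdepth root par B) :
    sconSet X root par Csize A = {B} := by
  have hpos : 0 < (conSet X par A).ncard := (Set.ncard_pos (Set.toFinite _)).2 ⟨B, hB⟩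
  have hmin : min (Csize A) (conSet X par A).ncard = 1 := by omega
  ext D
  simp only [sconSet, hmin, Nat.lt_one_iff, Set.mem_ofPred_eq, Set.mem_singleton_iff,
    Set.ncard_eq_zero (Set.toFinite _), Set.eq_empty_iff_forall_notMem, not_and]
  constructor
  · rintro ⟨hD, h0⟩
    by_contra hne
    exact h0 B hB (hlt D hD hne)
  · rintro rfl
    refine ⟨hB, fun B' hB' h' => ?_⟩
    by_cases hne : B' = D
    · subst hne
      exact lt_irrefl _ h'
    · exact lt_asymm h' (hlt B' hB' hne)

/-- For the scalar query `Q_hex` with variables `{a,b,c,d,e,f}`, output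
variables `∅`, and atoms `{a,b}, {a,c}, {a,d}, {a,e}, {a,f}, {b,c}, {b,d}, {b,e}, {b,f},
{c,d}, {d,e}, {e,f}`, there is a PTCR with `s ≤ 1` and `t ≤ 2`; indeed, the path
pseudo-tree `a → b → c → d → e → f` with cache sizes `C(e) = C(f) = 1` and `C = 0`
elsewhere achieves `s = 1` and `t = 2`. -/
theorem stmt_16 {V : Type*} [Fintype V] [DecidableEq V]
    (a b c d e f : V)
    (hdist : ([a, b, c, d, e, f] : List V).Nodup)
    (hV : ∀ x : V, x = a ∨ x = b ∨ x = c ∨ x = d ∨ x = e ∨ x = f)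
    (X : Fin 12 → Finset V)
    (hX : X 0 = {a, b} ∧ X 1 = {a, c} ∧ X 2 = {a, d} ∧ X 3 = {a, e} ∧ X 4 = {a, f} ∧
          X 5 = {b, c} ∧ X 6 = {b, d} ∧ X 7 = {b, e} ∧ X 8 = {b, f} ∧
          X 9 = {c, d} ∧ X 10 = {d, e} ∧ X 11 = {e, f}) :
    let par₀ : V → V := fun x =>
      if x = b then a else if x = c then b else if x = d then c
      else if x = e then d else if x = f then e else a
    let C₀ : V → ℕ := fun x => if x = e ∨ x = f then 1 else 0
    (∃ (root : V) (par : V → V) (Csize : V → ℕ) (ria ra : V → Set V),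
      IsRootedTree root par ∧ IsPseudoTree X par ∧
      (∀ A, iconSet X root par Csize A = ∅ → ria A = ∅) ∧
      (∀ A B, B ∈ iconSet X root par Csize A →
        iconSet X root par Csize A ⊆ ancc par B → ria A = ra (par A) ∩ ancc par B) ∧
      (∀ A, ra A = ria A ∪ sconSet X root par Csize A ∪ {A}) ∧
      sPTCR X (∅ : Set V) root par Csize ≤ 1 ∧ tPTCR X (∅ : Set V) par ra ≤ 2) ∧
    (IsRootedTree a par₀ ∧ IsPseudoTree X par₀ ∧
      ∀ (ria ra : V → Set V),
        (∀ A, iconSet X a par₀ C₀ A = ∅ → ria A = ∅) →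
        (∀ A B, B ∈ iconSet X a par₀ C₀ A →
          iconSet X a par₀ C₀ A ⊆ ancc par₀ B → ria A = ra (par₀ A) ∩ ancc par₀ B) →
        (∀ A, ra A = ria A ∪ sconSet X a par₀ C₀ A ∪ {A}) →
        sPTCR X (∅ : Set V) a par₀ C₀ = 1 ∧ tPTCR X (∅ : Set V) par₀ ra = 2) := by
  intro par₀ C₀
  have hne' := List.nodup_reverse.2 hdist
  simp only [List.reverse_cons, List.reverse_nil, List.nil_append, List.cons_append,
    List.nodup_cons, List.mem_cons, List.not_mem_nil, not_or, or_false, not_false_eq_true,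
    List.nodup_nil, and_true] at hdist hne'
  obtain ⟨h0, h1, h2, h3, h4, h5, h6, h7, h8, h9, h10, h11⟩ := hX
  have pa : par₀ a = a := by simp [par₀, hdist]
  have pb : par₀ b = a := by simp [par₀]
  have pc : par₀ c = b := by simp [par₀, hne']
  have pd : par₀ d = c := by simp [par₀, hne']
  have pe : par₀ e = d := by simp [par₀, hne']
  have pf : par₀ f = e := by simp [par₀, hne']
  have ca : C₀ a = 0 := by simp [C₀, hdist]
  have cb : C₀ b = 0 := by simp [C₀, hdist]
  have cc : C₀ c = 0 := by simp [C₀, hdist]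
  have cd : C₀ d = 0 := by simp [C₀, hdist]
  have ce : C₀ e = 1 := by simp [C₀]
  have cf : C₀ f = 1 := by simp [C₀]
  clear_value par₀ C₀
  have hall : ∀ p : V → Prop, p a → p b → p c → p d → p e → p f → ∀ x, p x := by
    intro p _ _ _ _ _ _ x
    rcases hV x with rfl | rfl | rfl | rfl | rfl | rfl <;> assumption
  have hex : ∀ p : V → Prop, (∃ x, p x) ↔ (p a ∨ p b ∨ p c ∨ p d ∨ p e ∨ p f) := by
    intro p
    constructor
    · rintro ⟨x, hx⟩
      rcases hV x with rfl | rfl | rfl | rfl | rfl | rfl <;> simp [hx]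
    · rintro (h | h | h | h | h | h) <;> exact ⟨_, h⟩
  have Aa : ancc par₀ a = {a} := ancc_of_fixed pa
  have Ab : ancc par₀ b = {b, a} := by rw [ancc_eq_insert, pb, Aa]
  have Ac : ancc par₀ c = {c, b, a} := by rw [ancc_eq_insert, pc, Ab]
  have Ad : ancc par₀ d = {d, c, b, a} := by rw [ancc_eq_insert, pd, Ac]
  have Ae : ancc par₀ e = {e, d, c, b, a} := by rw [ancc_eq_insert, pe, Ad]
  have Af : ancc par₀ f = {f, e, d, c, b, a} := by rw [ancc_eq_insert, pf, Ae]
  have hT : IsRootedTree a par₀ := by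
    refine ⟨pa, fun x => ?_⟩
    change a ∈ ancc par₀ x
    revert x
    apply hall <;> simp [Aa, Ab, Ac, Ad, Ae, Af]
  have hP : IsPseudoTree X par₀ := by
    refine fun i => ⟨f, fun x _ => ?_⟩
    revert x
    rw [Af]
    apply hall <;> simp
  have ta : tdepth a par₀ a = 0 := tdepth_root a par₀
  have tb : tdepth a par₀ b = 1 := by rw [tdepth_eq_succ hT (by simp [hne']), pb, ta]
  have tc : tdepth a par₀ c = 2 := by rw [tdepth_eq_succ hT (by simp [hne']), pc, tb]
  have td : tdepth a par₀ d = 3 := by rw [tdepth_eq_succ hT (by simp [hne']), pd, tc]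
  have te : tdepth a par₀ e = 4 := by rw [tdepth_eq_succ hT (by simp [hne']), pe, td]
  have hcon : ∀ A B, B ∈ conSet X par₀ A ↔
      B ∈ ancc par₀ A ∧ B ≠ A ∧ ∃ C, A ∈ ancc par₀ C ∧ ∃ i, B ∈ X i ∧ C ∈ X i := by
    intro A B
    exact and_assoc
  have hedge : ∀ B C, (∃ i, B ∈ X i ∧ C ∈ X i) ↔ (B ∈ X 0 ∧ C ∈ X 0 ∨ B ∈ X 1 ∧ C ∈ X 1 ∨
      B ∈ X 2 ∧ C ∈ X 2 ∨ B ∈ X 3 ∧ C ∈ X 3 ∨ B ∈ X 4 ∧ C ∈ X 4 ∨ B ∈ X 5 ∧ C ∈ X 5 ∨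
      B ∈ X 6 ∧ C ∈ X 6 ∨ B ∈ X 7 ∧ C ∈ X 7 ∨ B ∈ X 8 ∧ C ∈ X 8 ∨ B ∈ X 9 ∧ C ∈ X 9 ∨
      B ∈ X 10 ∧ C ∈ X 10 ∨ B ∈ X 11 ∧ C ∈ X 11) := by
    intro B C
    constructor
    · rintro ⟨i, hi⟩
      fin_cases i <;> simp at hi <;> simp [hi]
    · rintro (h | h | h | h | h | h | h | h | h | h | h | h) <;> exact ⟨_, h⟩
  simp only [h0, h1, h2, h3, h4, h5, h6, h7, h8, h9, h10, h11, Finset.mem_insert,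
    Finset.mem_singleton] at hedge
  simp only [hex, hedge] at hcon
  have Ka : conSet X par₀ a = ∅ := by
    apply Set.ext
    apply hall <;> simp [hcon, Aa, Ab, Ac, Ad, Ae, Af, hdist, hne']
  have Kb : conSet X par₀ b = {a} := by
    apply Set.ext
    apply hall <;> simp [hcon, Aa, Ab, Ac, Ad, Ae, Af, hdist, hne']
  have Kc : conSet X par₀ c = {a, b} := by
    apply Set.ext
    apply hall <;> simp [hcon, Aa, Ab, Ac, Ad, Ae, Af, hdist, hne']
  have Kd : conSet X par₀ d = {a, b, c} := by
    apply Set.ext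
    apply hall <;> simp [hcon, Aa, Ab, Ac, Ad, Ae, Af, hdist, hne']
  have Ke : conSet X par₀ e = {a, b, d} := by
    apply Set.ext
    apply hall <;> simp [hcon, Aa, Ab, Ac, Ad, Ae, Af, hdist, hne']
  have Kf : conSet X par₀ f = {a, b, e} := by
    apply Set.ext
    apply hall <;> simp [hcon, Aa, Ab, Ac, Ad, Ae, Af, hdist, hne']
  clear hcon hedge hex
  have Sa : sconSet X a par₀ C₀ a = ∅ := sconSet_of_size_zero X a par₀ ca
  have Sb : sconSet X a par₀ C₀ b = ∅ := sconSet_of_size_zero X a par₀ cb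
  have Sc : sconSet X a par₀ C₀ c = ∅ := sconSet_of_size_zero X a par₀ cc
  have Sd : sconSet X a par₀ C₀ d = ∅ := sconSet_of_size_zero X a par₀ cd
  have Se : sconSet X a par₀ C₀ e = {d} := by
    apply sconSet_of_size_one X a par₀ ce
    · simp [Ke]
    · simp [Ke, ta, tb, td]
  have Sf : sconSet X a par₀ C₀ f = {e} := by
    apply sconSet_of_size_one X a par₀ cf
    · simp [Kf]
    · simp [Kf, ta, tb, te]
  have Ia : iconSet X a par₀ C₀ a = ∅ := by
    rw [iconSet, Ka, Sa]
    exact Set.sdiff_empty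
  have Ib : iconSet X a par₀ C₀ b = {a} := by
    rw [iconSet, Kb, Sb]
    exact Set.sdiff_empty
  have Ic : iconSet X a par₀ C₀ c = {a, b} := by
    rw [iconSet, Kc, Sc]
    exact Set.sdiff_empty
  have Id : iconSet X a par₀ C₀ d = {a, b, c} := by
    rw [iconSet, Kd, Sd]
    exact Set.sdiff_empty
  have Ie : iconSet X a par₀ C₀ e = {a, b} := by
    rw [iconSet, Ke, Se]
    apply Set.ext
    apply hall <;> simp [hdist, hne']
  have If : iconSet X a par₀ C₀ f = {a, b} := by
    rw [iconSet, Kf, Sf]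
    apply Set.ext
    apply hall <;> simp [hdist, hne']
  have main : ∀ ria ra : V → Set V,
      (∀ A, iconSet X a par₀ C₀ A = ∅ → ria A = ∅) →
      (∀ A B, B ∈ iconSet X a par₀ C₀ A →
        iconSet X a par₀ C₀ A ⊆ ancc par₀ B → ria A = ra (par₀ A) ∩ ancc par₀ B) →
      (∀ A, ra A = ria A ∪ sconSet X a par₀ C₀ A ∪ {A}) →
      sPTCR X (∅ : Set V) a par₀ C₀ = 1 ∧ tPTCR X (∅ : Set V) par₀ ra = 2 := by
    intro ria ra hr0 hr hra
    have Ra : ra a = {a} := by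
      rw [hra, hr0 a Ia, Sa]
      simp
    have Rb : ra b = {a, b} := by
      rw [hra, hr b a (by simp [Ib]) (by simp [Ib, Aa]), pb,
        Ra, Aa, Sb]
      apply Set.ext
      apply hall <;> simp [hdist, hne']
    have Rc : ra c = {a, b, c} := by
      rw [hra, hr c b (by simp [Ic]) (by simp [Ic, Ab, Set.insert_subset_iff]), pc,
        Rb, Ab, Sc]
      apply Set.ext
      apply hall <;> simp [hdist, hne']
    have Rd : ra d = {a, b, c, d} := by
      rw [hra, hr d c (by simp [Id]) (by simp [Id, Ac, Set.insert_subset_iff]), pd,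
        Rc, Ac, Sd]
      apply Set.ext
      apply hall <;> simp [hdist, hne']
    have Re : ra e = {a, b, d, e} := by
      rw [hra, hr e b (by simp [Ie]) (by simp [Ie, Ab, Set.insert_subset_iff]), pe,
        Rd, Ab, Se]
      apply Set.ext
      apply hall <;> simp [hdist, hne']
    have Rf : ra f = {a, b, e, f} := by
      rw [hra, hr f b (by simp [If]) (by simp [If, Ab, Set.insert_subset_iff]), pf,
        Re, Ab, Sf]
      apply Set.ext
      apply hall <;> simp [hdist, hne']
    have hcov : ∀ A, ∃ i, A ∈ X i := by
      apply hall
      exacts [⟨0, by simp [h0]⟩, ⟨0, by simp [h0]⟩, ⟨9, by simp [h9]⟩, ⟨9, by simp [h9]⟩,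
        ⟨11, by simp [h11]⟩, ⟨11, by simp [h11]⟩]
    have : Nonempty V := ⟨a⟩
    constructor
    · apply le_antisymm
      · apply ciSup_le
        apply hall <;> simp only [Set.inter_empty, Set.union_empty, Sa, Sb, Sc, Sd, Se, Sf]
        iterate 4 exact (rhoStar_le_card X ∅ ∅ (by simp)).trans (by simp)
        · exact (rhoStar_le_card X _ {9} (by simp [h9])).trans (by simp)
        · exact (rhoStar_le_card X _ {11} (by simp [h11])).trans (by simp)
      · refine le_trans ?_ (le_ciSup (Set.finite_range _).bddAbove e)
        simp only [Set.inter_empty, Set.union_empty, Se]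
        simpa using card_le_mul_rhoStar X {d} (fun A _ => hcov A) {d} (by simp) 1 one_pos
          fun i => Finset.card_le_card Finset.inter_subset_left
    · apply le_antisymm
      · apply ciSup_le
        apply hall <;> simp only [Set.inter_empty, Set.union_empty, Ra, Rb, Rc, Rd, Re, Rf]
        iterate 4 exact (rhoStar_le_card X _ {0, 9} (by simp [h0, h9])).trans (by simp)
        · exact (rhoStar_le_card X _ {0, 10} (by simp [h0, h10])).trans (by simp)
        · exact (rhoStar_le_card X _ {0, 11} (by simp [h0, h11])).trans (by simp)
      · refine le_trans ?_ (le_ciSup (Set.finite_range _).bddAbove d)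
        simp only [Set.inter_empty, Set.union_empty, Rd]
        have hcard : ∀ i, (X i).card ≤ 2 := by
          intro i
          fin_cases i <;>
            simp only [Fin.reduceFinMk, Fin.zero_eta, Fin.mk_one, h0, h1, h2, h3, h4, h5, h6, h7,
              h8, h9, h10, h11, Finset.card_le_two]
        have h := card_le_mul_rhoStar X {a, b, c, d} (fun A _ => hcov A) {a, b, c, d} (by simp) 2
          two_pos fun i => (Finset.card_le_card Finset.inter_subset_right).trans (hcard i)
        have hcard4 : ({a, b, c, d} : Finset V).card = 4 := by simp [hdist]
        rw [hcard4] at h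
        push_cast at h
        linarith
  refine ⟨?_, hT, hP, main⟩
  obtain ⟨ria, ra, hr0, hr, hra⟩ : ∃ ria ra : V → Set V,
      (∀ A, iconSet X a par₀ C₀ A = ∅ → ria A = ∅) ∧
      (∀ A B, B ∈ iconSet X a par₀ C₀ A →
        iconSet X a par₀ C₀ A ⊆ ancc par₀ B → ria A = ra (par₀ A) ∩ ancc par₀ B) ∧
      (∀ A, ra A = ria A ∪ sconSet X a par₀ C₀ A ∪ {A}) := by
    let ria : V → Set V := fun x => if x = a then ∅ else if x = b then {a}
      else if x = d then {a, b, c} else {a, b}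
    have ra' : ria a = ∅ := by simp [ria]
    have rb' : ria b = {a} := by simp [ria, hne']
    have rc' : ria c = {a, b} := by simp [ria, hdist, hne']
    have rd' : ria d = {a, b, c} := by simp [ria, hne']
    have re' : ria e = {a, b} := by simp [ria, hne']
    have rf' : ria f = {a, b} := by simp [ria, hne']
    clear_value ria
    refine ⟨ria, fun x => ria x ∪ sconSet X a par₀ C₀ x ∪ {x}, ?_, ?_, fun _ => rfl⟩
    · apply hall <;> simp [Ia, Ib, Ic, Id, Ie, If, ra', (Set.insert_nonempty _ _).ne_empty]
    · apply hall <;> apply hall <;>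
        simp only [Ia, Ib, Ic, Id, Ie, If, Aa, Ab, Ac, pa, pb, pc, pd, pe, pf, ra', rb', rc', rd',
          re', rf', Sa, Sb, Sc, Sd, Se]
      all_goals simp [Set.insert_subset_iff, hdist, hne']
      all_goals
        apply Set.ext
        apply hall <;> simp [hdist, hne']
  obtain ⟨hs, ht⟩ := main ria ra hr0 hr hra
  exact ⟨a, par₀, C₀, ria, ra, hT, hP, hr0, hr, hra, hs.le, ht.le⟩
end
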